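/- arXiv:2501.00653 — 4 statements merged into one kernel-verified Lean document; each statement's English description precedes it below -/
import Mathlib

section
/- Let n ≥ 2 and 1 ≤ k ≤ n−1, and let u¹,…,uᵐ ∈ ℝⁿ (unit vectors) with weights λ₁,…,λₘ > 0 form a John decomposition. Let E be the k-ellipsoid with orthonormal axis directions v¹,…,vᵏ, center c and semi-axes α₁,…,α_k > 0, and suppose ⟨x,uᵢ⟩ ≤ 1 for every x ∈ E and every i. Then ∏ⱼ αⱼ ≤ (n(n+1)/(k(k+1)))^{k/2}. Moreover, if equality holds, then: (i) αⱼ = √(n(n+1)/(k(k+1))) for every j; and (ii) ‖c‖² = n(n−k)/(k+1), ⟨c,vⱼ⟩ = 0 for every j ∈ {1,…,k}, and for every i ∈ {1,…,m} either ⟨c,uᵢ⟩ = 1 or ⟨c,uᵢ⟩ = (k−n)/(k+1). -/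
open scoped InnerProductSpace BigOperators

section JohnDecomposition

variable {n m : ℕ} {u : Fin m → EuclideanSpace ℝ (Fin n)} {lam : Fin m → ℝ}

theorem john_sum_inner_mul_inner
    (hdecomp : ∀ x : EuclideanSpace ℝ (Fin n), ∑ i, (lam i * ⟪u i, x⟫_ℝ) • u i = x)
    (x y : EuclideanSpace ℝ (Fin n)) :
    ∑ i, lam i * (⟪u i, x⟫_ℝ * ⟪u i, y⟫_ℝ) = ⟪x, y⟫_ℝ := by
  conv_rhs => rw [← hdecomp x]
  rw [sum_inner]
  exact Finset.sum_congr rfl fun i _ => by rw [real_inner_smul_left]; ring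

theorem john_sum_inner (hsum : ∑ i, lam i • u i = 0) (x : EuclideanSpace ℝ (Fin n)) :
    ∑ i, lam i * ⟪u i, x⟫_ℝ = 0 := by
  have h : ⟪∑ i, lam i • u i, x⟫_ℝ = 0 := by rw [hsum, inner_zero_left]
  simpa only [sum_inner, real_inner_smul_left] using h

theorem john_sum_weights (hu : ∀ i, ‖u i‖ = 1)
    (hdecomp : ∀ x : EuclideanSpace ℝ (Fin n), ∑ i, (lam i * ⟪u i, x⟫_ℝ) • u i = x) :
    ∑ i, lam i = n := by
  have hb := EuclideanSpace.basisFun (Fin n) ℝ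
  calc ∑ i, lam i = ∑ i, lam i * ∑ l, (⟪u i, hb l⟫_ℝ * ⟪u i, hb l⟫_ℝ) := by
        refine Finset.sum_congr rfl fun i _ => ?_
        have h := hb.sum_inner_mul_inner (u i) (u i)
        simp only [real_inner_self_eq_norm_sq, hu i, one_pow] at h
        simp only [real_inner_comm (u i) (hb _)] at h
        rw [h, mul_one]
    _ = ∑ l, ∑ i, lam i * (⟪u i, hb l⟫_ℝ * ⟪u i, hb l⟫_ℝ) := by
        simp only [Finset.mul_sum]
        exact Finset.sum_comm
    _ = n := by
        simp only [john_sum_inner_mul_inner hdecomp, real_inner_self_eq_norm_sq,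
          hb.norm_eq_one, one_pow, Finset.sum_const, Finset.card_univ, Fintype.card_fin,
          nsmul_eq_mul, mul_one]

end JohnDecomposition

/-- The slack `1 - ⟪z, u⟫` is controlled by `‖z‖`, strictly so unless `z = -ρ • u`. -/
theorem two_mul_one_sub_inner_add_le {n : ℕ} (hn : 0 < n) {u : EuclideanSpace ℝ (Fin n)}
    (hu : ‖u‖ = 1) (z : EuclideanSpace ℝ (Fin n)) (ρ : ℝ) :
    2 * ρ * (1 - ⟪z, u⟫_ℝ) + ‖z + ρ • u‖ ^ 2 ≤ ‖z‖ ^ 2 + n + ρ ^ 2 * ((n + 1) / n) := by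
  have hn' : (0 : ℝ) < n := by exact_mod_cast hn
  have h1 : ‖z + ρ • u‖ ^ 2 = ‖z‖ ^ 2 + 2 * ρ * ⟪z, u⟫_ℝ + ρ ^ 2 := by
    rw [norm_add_sq_real, real_inner_smul_right, norm_smul, hu, mul_one, Real.norm_eq_abs, sq_abs]
    ring
  have h2 : (n : ℝ) + ρ ^ 2 * ((n + 1) / n) - ρ ^ 2 - 2 * ρ = (n - ρ) ^ 2 / n := by
    field_simp
    ring
  have h3 : 0 ≤ ((n : ℝ) - ρ) ^ 2 / n := by positivity
  rw [h1]
  linarith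

section InscribedEllipsoid

variable {n k m : ℕ} {u : Fin m → EuclideanSpace ℝ (Fin n)} {lam : Fin m → ℝ}
  {v : Fin k → EuclideanSpace ℝ (Fin n)} {c : EuclideanSpace ℝ (Fin n)} {α : Fin k → ℝ}

/-- The half-width of the centred ellipsoid with axes `v j` and semi-axes `α j` in direction `u`. -/
noncomputable def ellipsoidWidth (v : Fin k → EuclideanSpace ℝ (Fin n)) (α : Fin k → ℝ)
    (u : EuclideanSpace ℝ (Fin n)) : ℝ :=
  Real.sqrt (∑ j, (α j * ⟪u, v j⟫_ℝ) ^ 2)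

/-- Ball coordinates of the point of the ellipsoid that is extremal in direction `u`
(zero if `u` is orthogonal to the ellipsoid). -/
noncomputable def ellipsoidDir (v : Fin k → EuclideanSpace ℝ (Fin n)) (α : Fin k → ℝ)
    (u : EuclideanSpace ℝ (Fin n)) (j : Fin k) : ℝ :=
  α j * ⟪u, v j⟫_ℝ / ellipsoidWidth v α u

theorem ellipsoidWidth_nonneg (w : EuclideanSpace ℝ (Fin n)) : 0 ≤ ellipsoidWidth v α w :=
  Real.sqrt_nonneg _

theorem ellipsoidWidth_sq (w : EuclideanSpace ℝ (Fin n)) :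
    ellipsoidWidth v α w ^ 2 = ∑ j, (α j * ⟪w, v j⟫_ℝ) ^ 2 :=
  Real.sq_sqrt (Finset.sum_nonneg fun _ _ => sq_nonneg _)

theorem ellipsoidWidth_mul_dir (w : EuclideanSpace ℝ (Fin n)) (j : Fin k) :
    ellipsoidWidth v α w * ellipsoidDir v α w j = α j * ⟪w, v j⟫_ℝ := by
  by_cases h : ellipsoidWidth v α w = 0
  · have h2 := ellipsoidWidth_sq (v := v) (α := α) w
    rw [h, zero_pow two_ne_zero, eq_comm,
      Finset.sum_eq_zero_iff_of_nonneg fun _ _ => sq_nonneg _] at h2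
    rw [h, zero_mul, pow_eq_zero_iff two_ne_zero |>.1 (h2 j (Finset.mem_univ j))]
  · rw [ellipsoidDir, mul_div_cancel₀ _ h]

theorem sum_ellipsoidDir_sq_le (w : EuclideanSpace ℝ (Fin n)) :
    ∑ j, ellipsoidDir v α w j ^ 2 ≤ 1 := by
  simp only [ellipsoidDir, div_pow]
  rw [← Finset.sum_div, ← ellipsoidWidth_sq]
  exact div_self_le_one _

theorem ellipsoidWidth_le (hα : ∀ j, 0 < α j) {w : EuclideanSpace ℝ (Fin n)}
    (hE : ∀ t : Fin k → ℝ, ∑ j, t j ^ 2 / α j ^ 2 ≤ 1 → ⟪c + ∑ j, t j • v j, w⟫_ℝ ≤ 1) :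
    ellipsoidWidth v α w ≤ 1 - ⟪w, c⟫_ℝ := by
  have h := hE (fun j => α j * ellipsoidDir v α w j) (by
    refine le_trans (le_of_eq ?_) (sum_ellipsoidDir_sq_le (v := v) (α := α) w)
    refine Finset.sum_congr rfl fun j _ => ?_
    have := (hα j).ne'
    field_simp)
  have h2 : ∑ j, α j * ellipsoidDir v α w j * ⟪w, v j⟫_ℝ = ellipsoidWidth v α w := by
    have h3 : ∑ j, α j * ellipsoidDir v α w j * ⟪w, v j⟫_ℝ =
        ellipsoidWidth v α w ^ 2 / ellipsoidWidth v α w := by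
      rw [ellipsoidWidth_sq, Finset.sum_div]
      exact Finset.sum_congr rfl fun j _ => by rw [ellipsoidDir]; ring
    rw [h3, pow_two, mul_self_div_self]
  rw [real_inner_comm, inner_add_right, inner_sum] at h
  simp only [real_inner_smul_right] at h
  rw [h2] at h
  linarith

/-- The inequality obtained by testing with the two points `c ± g • e`, where `e` is the touching
direction, weighted by the slacks at the two opposite points of the ellipsoid. -/
theorem ellipsoid_pointwise_le (hn : 0 < n) (hv : Orthonormal ℝ v)
    {w : EuclideanSpace ℝ (Fin n)} (hw : ‖w‖ = 1)
    (hle : ellipsoidWidth v α w ≤ 1 - ⟪w, c⟫_ℝ) (g ρ : ℝ) :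
    2 * ρ * ((1 - ⟪w, c⟫_ℝ) ^ 2 + g * ∑ j, α j * ⟪w, v j⟫_ℝ ^ 2)
      + (1 - ⟪w, c⟫_ℝ + ellipsoidWidth v α w) / 2
        * ‖c - g • ∑ j, ellipsoidDir v α w j • v j + ρ • w‖ ^ 2
      ≤ (1 - ⟪w, c⟫_ℝ) * (n + ‖c‖ ^ 2 + g ^ 2 + ρ ^ 2 * ((n + 1) / n))
        - 2 * g * ∑ j, α j * ⟪c, v j⟫_ℝ * ⟪w, v j⟫_ℝ := by
  have h0 := ellipsoidWidth_nonneg (v := v) (α := α) w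
  have hws := ellipsoidWidth_mul_dir (v := v) (α := α) w
  have hs := sum_ellipsoidDir_sq_le (v := v) (α := α) w
  set h := ellipsoidWidth v α w
  set e := ellipsoidDir v α w
  set s := ∑ j, e j • v j with hsdef
  have hss : ‖s‖ ^ 2 ≤ 1 := by
    rw [← real_inner_self_eq_norm_sq, hsdef, hv.inner_sum]
    simpa [pow_two] using hs
  have hq : h * ⟪s, w⟫_ℝ = ∑ j, α j * ⟪w, v j⟫_ℝ ^ 2 := by
    rw [hsdef, sum_inner, Finset.mul_sum]
    refine Finset.sum_congr rfl fun j _ => ?_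
    rw [real_inner_smul_left, real_inner_comm w, ← mul_assoc, hws]
    ring
  have hd : h * ⟪c, s⟫_ℝ = ∑ j, α j * ⟪c, v j⟫_ℝ * ⟪w, v j⟫_ℝ := by
    rw [hsdef, inner_sum, Finset.mul_sum]
    refine Finset.sum_congr rfl fun j _ => ?_
    rw [real_inner_smul_right, mul_left_comm, mul_comm, mul_right_comm, hws]
    ring
  have hm := two_mul_one_sub_inner_add_le hn hw (c - g • s) ρ
  have hp := two_mul_one_sub_inner_add_le hn hw (c + g • s) ρ
  have hp0 : 0 ≤ ‖c + g • s + ρ • w‖ ^ 2 := sq_nonneg _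
  have hg : ‖g • s‖ ^ 2 ≤ g ^ 2 := by
    rw [norm_smul, mul_pow, Real.norm_eq_abs, sq_abs]
    nlinarith [sq_nonneg g]
  rw [norm_sub_sq_real, inner_sub_left, real_inner_smul_left, real_inner_smul_right,
    real_inner_comm w c] at hm
  rw [norm_add_sq_real c, inner_add_left, real_inner_smul_left, real_inner_smul_right,
    real_inner_comm w c] at hp
  rw [← hq, ← hd]
  have key1 : 0 ≤ (1 - ⟪w, c⟫_ℝ + h) / 2 * (‖c‖ ^ 2 - 2 * (g * ⟪c, s⟫_ℝ) + g ^ 2 + n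
      + ρ ^ 2 * ((n + 1) / n) - 2 * ρ * (1 - (⟪w, c⟫_ℝ - g * ⟪s, w⟫_ℝ))
      - ‖c - g • s + ρ • w‖ ^ 2) :=
    mul_nonneg (by linarith) (by linarith)
  have key2 : 0 ≤ (1 - ⟪w, c⟫_ℝ - h) / 2 * (‖c‖ ^ 2 + 2 * (g * ⟪c, s⟫_ℝ) + g ^ 2 + n
      + ρ ^ 2 * ((n + 1) / n) - 2 * ρ * (1 - (⟪w, c⟫_ℝ + g * ⟪s, w⟫_ℝ))) :=
    mul_nonneg (by linarith) (by linarith)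
  linarith

theorem john_sum_ellipsoidWidth_sq (hv : Orthonormal ℝ v)
    (hdecomp : ∀ x : EuclideanSpace ℝ (Fin n), ∑ i, (lam i * ⟪u i, x⟫_ℝ) • u i = x) :
    ∑ i, lam i * ellipsoidWidth v α (u i) ^ 2 = ∑ j, α j ^ 2 := by
  simp only [ellipsoidWidth_sq, Finset.mul_sum]
  rw [Finset.sum_comm]
  refine Finset.sum_congr rfl fun j _ => ?_
  have h := john_sum_inner_mul_inner hdecomp (v j) (v j)
  rw [real_inner_self_eq_norm_sq, hv.1 j, one_pow] at h
  rw [← mul_one (α j ^ 2), ← h, Finset.mul_sum]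
  exact Finset.sum_congr rfl fun i _ => by ring

theorem john_sum_one_sub_inner_sq (hu : ∀ i, ‖u i‖ = 1) (hsum : ∑ i, lam i • u i = 0)
    (hdecomp : ∀ x : EuclideanSpace ℝ (Fin n), ∑ i, (lam i * ⟪u i, x⟫_ℝ) • u i = x)
    (c : EuclideanSpace ℝ (Fin n)) :
    ∑ i, lam i * (1 - ⟪u i, c⟫_ℝ) ^ 2 = n + ‖c‖ ^ 2 := by
  rw [← real_inner_self_eq_norm_sq, ← john_sum_inner_mul_inner hdecomp c c,
    ← john_sum_weights hu hdecomp,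
    ← add_zero (_ + _), ← mul_zero (-2 : ℝ), ← john_sum_inner hsum c, Finset.mul_sum,
    ← Finset.sum_add_distrib, ← Finset.sum_add_distrib]
  exact Finset.sum_congr rfl fun i _ => by ring

theorem john_sum_one_sub_inner (hu : ∀ i, ‖u i‖ = 1) (hsum : ∑ i, lam i • u i = 0)
    (hdecomp : ∀ x : EuclideanSpace ℝ (Fin n), ∑ i, (lam i * ⟪u i, x⟫_ℝ) • u i = x)
    (c : EuclideanSpace ℝ (Fin n)) :
    ∑ i, lam i * (1 - ⟪u i, c⟫_ℝ) = n := by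
  simp only [mul_sub, mul_one, Finset.sum_sub_distrib, john_sum_inner hsum,
    john_sum_weights hu hdecomp, sub_zero]

theorem ellipsoid_sum_le (hn : 0 < n) (hu : ∀ i, ‖u i‖ = 1) (hlam : ∀ i, 0 < lam i)
    (hsum : ∑ i, lam i • u i = 0)
    (hdecomp : ∀ x : EuclideanSpace ℝ (Fin n), ∑ i, (lam i * ⟪u i, x⟫_ℝ) • u i = x)
    (hv : Orthonormal ℝ v) (hle : ∀ i, ellipsoidWidth v α (u i) ≤ 1 - ⟪u i, c⟫_ℝ) (g ρ : ℝ) :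
    2 * ρ * (n + ‖c‖ ^ 2 + g * ∑ j, α j)
      + ∑ i, lam i * ((1 - ⟪u i, c⟫_ℝ + ellipsoidWidth v α (u i)) / 2
        * ‖c - g • ∑ j, ellipsoidDir v α (u i) j • v j + ρ • u i‖ ^ 2)
      ≤ n * (n + ‖c‖ ^ 2 + g ^ 2 + ρ ^ 2 * ((n + 1) / n)) := by
  have h := Finset.sum_le_sum fun i (_ : i ∈ Finset.univ) =>
    mul_le_mul_of_nonneg_left (ellipsoid_pointwise_le hn hv (hu i) (hle i) g ρ) (hlam i).le
  have htr : ∑ i, lam i * ∑ j, α j * ⟪u i, v j⟫_ℝ ^ 2 = ∑ j, α j := by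
    simp only [Finset.mul_sum]
    rw [Finset.sum_comm]
    refine Finset.sum_congr rfl fun j _ => ?_
    have h := john_sum_inner_mul_inner hdecomp (v j) (v j)
    rw [real_inner_self_eq_norm_sq, hv.1 j, one_pow] at h
    conv_rhs => rw [← mul_one (α j), ← h, Finset.mul_sum]
    exact Finset.sum_congr rfl fun i _ => by ring
  have hcr : ∑ i, lam i * ∑ j, α j * ⟪c, v j⟫_ℝ * ⟪u i, v j⟫_ℝ = 0 := by
    simp only [Finset.mul_sum]
    rw [Finset.sum_comm]
    refine Finset.sum_eq_zero fun j _ => ?_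
    rw [← mul_zero (α j * ⟪c, v j⟫_ℝ), ← john_sum_inner hsum (v j), Finset.mul_sum]
    exact Finset.sum_congr rfl fun i _ => by ring
  have hL : ∀ A : Fin m → ℝ, ∑ i, lam i * (2 * ρ * ((1 - ⟪u i, c⟫_ℝ) ^ 2
      + g * ∑ j, α j * ⟪u i, v j⟫_ℝ ^ 2) + A i)
      = 2 * ρ * (n + ‖c‖ ^ 2 + g * ∑ j, α j) + ∑ i, lam i * A i := by
    intro A
    rw [← john_sum_one_sub_inner_sq hu hsum hdecomp c, ← htr, Finset.mul_sum,
      ← Finset.sum_add_distrib, Finset.mul_sum, ← Finset.sum_add_distrib]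
    exact Finset.sum_congr rfl fun i _ => by ring
  have hR : ∀ K : ℝ, ∑ i, lam i * ((1 - ⟪u i, c⟫_ℝ) * K
      - 2 * g * ∑ j, α j * ⟪c, v j⟫_ℝ * ⟪u i, v j⟫_ℝ) = n * K := by
    intro K
    rw [← sub_zero ((n : ℝ) * K), ← mul_zero (2 * g), ← hcr,
      ← john_sum_one_sub_inner hu hsum hdecomp c, Finset.sum_mul, Finset.mul_sum,
      ← Finset.sum_sub_distrib]
    exact Finset.sum_congr rfl fun i _ => by ring
  rwa [hL, hR] at h

theorem sum_sq_semiaxes_le (hu : ∀ i, ‖u i‖ = 1) (hlam : ∀ i, 0 < lam i)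
    (hsum : ∑ i, lam i • u i = 0)
    (hdecomp : ∀ x : EuclideanSpace ℝ (Fin n), ∑ i, (lam i * ⟪u i, x⟫_ℝ) • u i = x)
    (hv : Orthonormal ℝ v) (hle : ∀ i, ellipsoidWidth v α (u i) ≤ 1 - ⟪u i, c⟫_ℝ) :
    ∑ j, α j ^ 2 ≤ n + ‖c‖ ^ 2 := by
  rw [← john_sum_ellipsoidWidth_sq hv hdecomp, ← john_sum_one_sub_inner_sq hu hsum hdecomp c]
  exact Finset.sum_le_sum fun i _ => mul_le_mul_of_nonneg_left
    (pow_le_pow_left₀ (ellipsoidWidth_nonneg _) (hle i) 2) (hlam i).le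

/-- The bound on the sum of the semi-axes; if it is attained then `n + ‖c‖ ^ 2 = k * G ^ 2`. -/
theorem sum_semiaxes_le (hn : 0 < n) (hk : 0 < k) (hu : ∀ i, ‖u i‖ = 1) (hlam : ∀ i, 0 < lam i)
    (hsum : ∑ i, lam i • u i = 0)
    (hdecomp : ∀ x : EuclideanSpace ℝ (Fin n), ∑ i, (lam i * ⟪u i, x⟫_ℝ) • u i = x)
    (hv : Orthonormal ℝ v) (hle : ∀ i, ellipsoidWidth v α (u i) ≤ 1 - ⟪u i, c⟫_ℝ)
    {G : ℝ} (hG : 0 < G) (hG2 : (k : ℝ) * (k + 1) * G ^ 2 = n * (n + 1)) :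
    ∑ j, α j ≤ k * G ∧ (∑ j, α j = k * G → n + ‖c‖ ^ 2 = k * G ^ 2) := by
  have hn' : (0 : ℝ) < n := by exact_mod_cast hn
  have hk' : (0 : ℝ) < k := by exact_mod_cast hk
  have hkG : 0 < k * G ^ 2 := by positivity
  have hsq := sum_sq_semiaxes_le hu hlam hsum hdecomp hv hle
  have hcs : (∑ j, α j) ^ 2 ≤ k * ∑ j, α j ^ 2 := by
    simpa using sq_sum_le_card_mul_sum_sq (s := Finset.univ) (f := α)
  obtain ⟨τ, hτ, hτ2⟩ : ∃ τ : ℝ, 0 < τ ∧ n + ‖c‖ ^ 2 = k * G ^ 2 * τ ^ 2 := by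
    refine ⟨Real.sqrt ((n + ‖c‖ ^ 2) / (k * G ^ 2)), by positivity, ?_⟩
    rw [Real.sq_sqrt (by positivity), mul_div_cancel₀ _ hkG.ne']
  have h := ellipsoid_sum_le hn hu hlam hsum hdecomp hv hle (k * G * τ) (n * τ)
  have hnonneg : 0 ≤ ∑ i, lam i * ((1 - ⟪u i, c⟫_ℝ + ellipsoidWidth v α (u i)) / 2
        * ‖c - (k * G * τ) • ∑ j, ellipsoidDir v α (u i) j • v j + (n * τ) • u i‖ ^ 2) := by
    refine Finset.sum_nonneg fun i _ => mul_nonneg (hlam i).le (mul_nonneg ?_ (sq_nonneg _))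
    linarith [hle i, ellipsoidWidth_nonneg (v := v) (α := α) (u i)]
  rw [hτ2] at h hsq
  set T := ∑ j, α j
  have hT1 : T ≤ k * G * τ :=
    le_of_sq_le_sq (by nlinarith) (by positivity)
  have hT2 : G * τ + T ≤ (k + 1) * G := by
    have e1 : (n : ℝ) * (k * G ^ 2 * τ ^ 2 + (k * G * τ) ^ 2 + (n * τ) ^ 2 * ((n + 1) / n))
        = 2 * n * k * G * τ ^ 2 * ((k + 1) * G) := by
      have : (n * τ) ^ 2 * (((n : ℝ) + 1) / n) = n * (n + 1) * τ ^ 2 := by field_simp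
      rw [this, ← hG2]
      ring
    have e2 : 2 * (n * τ) * (k * G ^ 2 * τ ^ 2 + k * G * τ * T)
        = 2 * n * k * G * τ ^ 2 * (G * τ + T) := by ring
    rw [e1, e2] at h
    exact le_of_mul_le_mul_left (by linarith) (by positivity : 0 < 2 * n * k * G * τ ^ 2)
  refine ⟨?_, fun hT => ?_⟩
  · have := mul_le_mul_of_nonneg_left hT2 hk'.le
    refine le_of_mul_le_mul_left (a := (k : ℝ) + 1) ?_ (by positivity)
    linarith
  · rw [hT] at hT1 hT2
    have h1 : 1 ≤ τ := le_of_mul_le_mul_left (by linarith) (by positivity : 0 < k * G)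
    have h2 : τ ≤ 1 := le_of_mul_le_mul_left (by linarith) hG
    rw [hτ2, le_antisymm h2 h1]
    ring

/-- When the bound is attained, every `u i` touching the ellipsoid nontrivially is antipodal to
`c - (k * G) • e`, with `e` the touching direction. -/
theorem ellipsoid_contact (hn : 0 < n) (hu : ∀ i, ‖u i‖ = 1)
    (hlam : ∀ i, 0 < lam i) (hsum : ∑ i, lam i • u i = 0)
    (hdecomp : ∀ x : EuclideanSpace ℝ (Fin n), ∑ i, (lam i * ⟪u i, x⟫_ℝ) • u i = x)
    (hv : Orthonormal ℝ v) (hle : ∀ i, ellipsoidWidth v α (u i) ≤ 1 - ⟪u i, c⟫_ℝ)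
    {G : ℝ} (hG2 : (k : ℝ) * (k + 1) * G ^ 2 = n * (n + 1))
    (hα : ∀ j, α j = G) (hc : n + ‖c‖ ^ 2 = k * G ^ 2) (i : Fin m) :
    ellipsoidWidth v α (u i) = 1 - ⟪u i, c⟫_ℝ ∧ (⟪u i, c⟫_ℝ ≠ 1 →
      c - (k * G) • ∑ j, ellipsoidDir v α (u i) j • v j + (n : ℝ) • u i = 0) := by
  have hn' : (0 : ℝ) < n := by exact_mod_cast hn
  have hw0 := fun i => ellipsoidWidth_nonneg (v := v) (α := α) (u i)
  have hwid : ellipsoidWidth v α (u i) = 1 - ⟪u i, c⟫_ℝ := by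
    have hz : ∑ i, lam i * ((1 - ⟪u i, c⟫_ℝ) ^ 2 - ellipsoidWidth v α (u i) ^ 2) = 0 := by
      simp only [mul_sub, Finset.sum_sub_distrib]
      rw [john_sum_ellipsoidWidth_sq hv hdecomp, john_sum_one_sub_inner_sq hu hsum hdecomp c, hc]
      simp [hα]
    have hz' := (Finset.sum_eq_zero_iff_of_nonneg fun i _ => mul_nonneg (hlam i).le
      (sub_nonneg.2 (pow_le_pow_left₀ (hw0 i) (hle i) 2))).1 hz i (Finset.mem_univ i)
    have h2 : ellipsoidWidth v α (u i) ^ 2 = (1 - ⟪u i, c⟫_ℝ) ^ 2 := by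
      have := (mul_eq_zero.1 hz').resolve_left (hlam i).ne'
      linarith
    exact (pow_left_inj₀ (hw0 i) ((hw0 i).trans (hle i)) two_ne_zero).1 h2
  refine ⟨hwid, fun hi => ?_⟩
  have h := ellipsoid_sum_le hn hu hlam hsum hdecomp hv hle (k * G) n
  have hT : ∑ j, α j = k * G := by simp [hα]
  have e1 : (n : ℝ) ^ 2 * ((n + 1) / n) = n * (n + 1) := by field_simp
  rw [hT, hc, e1, ← hG2] at h
  have hterm : ∀ i ∈ Finset.univ, 0 ≤ lam i * ((1 - ⟪u i, c⟫_ℝ + ellipsoidWidth v α (u i)) / 2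
        * ‖c - (k * G) • ∑ j, ellipsoidDir v α (u i) j • v j + (n : ℝ) • u i‖ ^ 2) :=
    fun i _ => mul_nonneg (hlam i).le
      (mul_nonneg (by linarith [hle i, hw0 i]) (sq_nonneg _))
  have h0 := (Finset.sum_eq_zero_iff_of_nonneg hterm).1
    (le_antisymm (by linarith) (Finset.sum_nonneg hterm)) i (Finset.mem_univ i)
  have hne : (1 - ⟪u i, c⟫_ℝ + ellipsoidWidth v α (u i)) / 2 ≠ 0 := by
    rw [hwid]
    intro h
    exact hi (by linarith)
  have h1 := ((mul_eq_zero.1 h0).resolve_left (hlam i).ne')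
  exact norm_eq_zero.1 (pow_eq_zero_iff two_ne_zero |>.1 ((mul_eq_zero.1 h1).resolve_left hne))

end InscribedEllipsoid

theorem eq_of_sum_eq_of_sum_sq_le {k : ℕ} {α : Fin k → ℝ} {G : ℝ}
    (h1 : ∑ j, α j = k * G) (h2 : ∑ j, α j ^ 2 ≤ k * G ^ 2) (j : Fin k) : α j = G := by
  have hz : ∑ j, (α j - G) ^ 2 ≤ 0 := by
    have e : ∑ j, (α j - G) ^ 2 = ∑ j, α j ^ 2 - 2 * G * ∑ j, α j + k * G ^ 2 := by
      have : (k : ℝ) * G ^ 2 = ∑ _j : Fin k, G ^ 2 := by simp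
      rw [this, Finset.mul_sum, ← Finset.sum_sub_distrib, ← Finset.sum_add_distrib]
      exact Finset.sum_congr rfl fun j _ => by ring
    rw [e, h1]
    linarith
  have h0 := (Finset.sum_eq_zero_iff_of_nonneg fun j _ => sq_nonneg (α j - G)).1
    (le_antisymm hz (Finset.sum_nonneg fun _ _ => sq_nonneg _)) j (Finset.mem_univ j)
  exact sub_eq_zero.1 (pow_eq_zero_iff two_ne_zero |>.1 h0)

theorem prod_le_sum_div_pow {k : ℕ} (hk : 0 < k) {α : Fin k → ℝ} (hα : ∀ j, 0 ≤ α j) :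
    ∏ j, α j ≤ ((∑ j, α j) / k) ^ k := by
  have hk' : (k : ℝ) ≠ 0 := by exact_mod_cast hk.ne'
  have h := Real.geom_mean_le_arith_mean_weighted Finset.univ (fun _ : Fin k => (k : ℝ)⁻¹) α
    (fun _ _ => by positivity) (by simp [hk']) (fun j _ => hα j)
  rw [← Finset.mul_sum, inv_mul_eq_div] at h
  have h0 : 0 ≤ ∏ j, α j ^ (k : ℝ)⁻¹ :=
    Finset.prod_nonneg fun j _ => Real.rpow_nonneg (hα j) _
  refine le_trans (le_of_eq ?_) (pow_le_pow_left₀ h0 h k)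
  rw [← Finset.prod_pow]
  exact Finset.prod_congr rfl fun j _ => (Real.rpow_inv_natCast_pow (hα j) hk.ne').symm

/-- Ball's upper bound for ellipsoids inscribed in a body in John
position, together with necessary conditions for equality. -/
theorem stmt4 (n k : ℕ) (hn : 2 ≤ n) (hk : 1 ≤ k) (hkn : k ≤ n - 1)
    (m : ℕ) (u : Fin m → EuclideanSpace ℝ (Fin n)) (lam : Fin m → ℝ)
    (hu : ∀ i, ‖u i‖ = 1) (hlam : ∀ i, 0 < lam i)
    (hsum : ∑ i, lam i • u i = 0)
    (hdecomp : ∀ x : EuclideanSpace ℝ (Fin n), ∑ i, (lam i * ⟪u i, x⟫_ℝ) • u i = x)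
    (v : Fin k → EuclideanSpace ℝ (Fin n)) (hv : Orthonormal ℝ v)
    (c : EuclideanSpace ℝ (Fin n))
    (α : Fin k → ℝ) (hα : ∀ j, 0 < α j)
    (Eell : Set (EuclideanSpace ℝ (Fin n)))
    (hEell : Eell = {x | ∃ t : Fin k → ℝ,
      ∑ j, (t j) ^ 2 / (α j) ^ 2 ≤ 1 ∧ x = c + ∑ j, t j • v j})
    (hEP : ∀ x ∈ Eell, ∀ i, ⟪x, u i⟫_ℝ ≤ 1) :
    ∏ j, α j ≤ Real.sqrt ((n : ℝ) * ((n : ℝ) + 1) / ((k : ℝ) * ((k : ℝ) + 1))) ^ k ∧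
    (∏ j, α j = Real.sqrt ((n : ℝ) * ((n : ℝ) + 1) / ((k : ℝ) * ((k : ℝ) + 1))) ^ k →
      (∀ j, α j = Real.sqrt ((n : ℝ) * ((n : ℝ) + 1) / ((k : ℝ) * ((k : ℝ) + 1)))) ∧
      ‖c‖ ^ 2 = (n : ℝ) * ((n : ℝ) - k) / ((k : ℝ) + 1) ∧
      (∀ j, ⟪c, v j⟫_ℝ = 0) ∧
      (∀ i, ⟪c, u i⟫_ℝ = 1 ∨ ⟪c, u i⟫_ℝ = ((k : ℝ) - n) / ((k : ℝ) + 1))) := by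
  have hn0 : 0 < n := by omega
  have hk0 : 0 < k := by omega
  have hn' : (0 : ℝ) < n := by exact_mod_cast hn0
  have hk' : (0 : ℝ) < k := by exact_mod_cast hk0
  set G := Real.sqrt ((n : ℝ) * ((n : ℝ) + 1) / ((k : ℝ) * ((k : ℝ) + 1))) with hGdef
  have hG : 0 < G := Real.sqrt_pos.2 (by positivity)
  have hG2 : (k : ℝ) * (k + 1) * G ^ 2 = n * (n + 1) := by
    rw [hGdef, Real.sq_sqrt (by positivity)]
    field_simp
  have hle : ∀ i, ellipsoidWidth v α (u i) ≤ 1 - ⟪u i, c⟫_ℝ := fun i =>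
    ellipsoidWidth_le hα fun t ht => hEP _ (hEell ▸ ⟨t, ht, rfl⟩) i
  obtain ⟨hT, hTeq⟩ := sum_semiaxes_le hn0 hk0 hu hlam hsum hdecomp hv hle hG hG2
  have hamgm := prod_le_sum_div_pow hk0 fun j => (hα j).le
  have hT0 : 0 ≤ (∑ j, α j) / k := div_nonneg (Finset.sum_nonneg fun j _ => (hα j).le) hk'.le
  refine ⟨hamgm.trans (pow_le_pow_left₀ hT0 ((div_le_iff₀' hk').2 hT) k), fun heq => ?_⟩
  rw [heq] at hamgm
  have hTG : ∑ j, α j = k * G :=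
    le_antisymm hT ((le_div_iff₀' hk').1 (le_of_pow_le_pow_left₀ hk0.ne' hT0 hamgm))
  have hc := hTeq hTG
  have hαG := eq_of_sum_eq_of_sum_sq_le hTG
    (hc ▸ sum_sq_semiaxes_le hu hlam hsum hdecomp hv hle)
  have hcon := ellipsoid_contact hn0 hu hlam hsum hdecomp hv hle hG2 hαG hc
  have hval : ∀ i, ⟪u i, c⟫_ℝ ≠ 1 → ((k : ℝ) + 1) * ⟪u i, c⟫_ℝ = k - n := by
    intro i hi
    obtain ⟨hw, hz⟩ := hcon i
    have h1 := congrArg (fun z => ellipsoidWidth v α (u i) * ⟪u i, z⟫_ℝ) (hz hi)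
    simp only [inner_add_right, inner_sub_right, real_inner_smul_right, inner_sum,
      real_inner_self_eq_norm_sq, hu i, inner_zero_right, mul_zero] at h1
    have h2 : ellipsoidWidth v α (u i) * ∑ j, ellipsoidDir v α (u i) j * ⟪u i, v j⟫_ℝ * G
        = ellipsoidWidth v α (u i) ^ 2 := by
      rw [ellipsoidWidth_sq, Finset.mul_sum]
      refine Finset.sum_congr rfl fun j _ => ?_
      rw [← mul_assoc, ← mul_assoc, ellipsoidWidth_mul_dir, hαG j]
      ring
    rw [← Finset.sum_mul] at h2
    have hne : 1 - ⟪u i, c⟫_ℝ ≠ 0 := fun h => hi (by linarith)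
    rw [hw] at h1 h2
    refine mul_left_cancel₀ hne ?_
    linear_combination h1 + k * h2
  refine ⟨hαG, ?_, ?_, fun i => ?_⟩
  · rw [eq_div_iff (by positivity)]
    linear_combination (k + 1) * hc + hG2
  · obtain ⟨i, hi⟩ : ∃ i, ⟪u i, c⟫_ℝ ≠ 1 := by
      by_contra! hall
      have h := john_sum_one_sub_inner hu hsum hdecomp c
      simp only [hall, sub_self, mul_zero, Finset.sum_const_zero] at h
      exact hn'.ne h
    intro j
    obtain ⟨hw, hz⟩ := hcon i
    have h1 := congrArg (fun z => ellipsoidWidth v α (u i) * ⟪z, v j⟫_ℝ) (hz hi)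
    have h3 : ⟪∑ l, ellipsoidDir v α (u i) l • v l, v j⟫_ℝ = ellipsoidDir v α (u i) j := by
      simpa using hv.inner_left_fintype (ellipsoidDir v α (u i)) j
    simp only [inner_add_left, inner_sub_left, real_inner_smul_left, h3, inner_zero_left,
      mul_zero] at h1
    have h2 := ellipsoidWidth_mul_dir (v := v) (α := α) (u i) j
    have hne : 1 - ⟪u i, c⟫_ℝ ≠ 0 := fun h => hi (by linarith)
    rw [hw] at h1 h2
    rw [hαG j] at h2
    have h4 := hval i hi
    have h5 : (1 - ⟪u i, c⟫_ℝ) * ((k + 1) * ⟪c, v j⟫_ℝ) = 0 := by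
      linear_combination ((k : ℝ) + 1) * h1 + (k + 1) * k * G * h2
        + ⟪u i, v j⟫_ℝ * hG2 + n * ⟪u i, v j⟫_ℝ * h4
    exact (mul_eq_zero.1 ((mul_eq_zero.1 h5).resolve_left hne)).resolve_left (by positivity)
  · rw [real_inner_comm, eq_div_iff (by positivity), or_iff_not_imp_left]
    intro hi
    linarith [hval i hi]
end

section
/- Let K ⊆ ℝ² be a convex body with B² ⊆ K admitting a John decomposition u¹,…,uᵐ, λ₁,…,λₘ with every uᵢ ∈ K and ⟨x,uᵢ⟩ ≤ 1 for all x ∈ K and all i (i.e., B² is the John ellipsoid of K). Let s ∈ [1,2] be the least ρ > 0 such that −(1/ρ)·x ∈ K for every x ∈ K (i.e., s is the John asymmetry of K), and set D_s := √(s² + 5 + √(4(2−s)² + (s²−1)²)). Then ‖x − y‖ ≤ D_s for all x, y ∈ K; moreover, for x, y ∈ K one has ‖x − y‖ = D_s if and only if ‖x‖ = ‖y‖ = √(D_s²/2 − 2) and ‖(x+y)/2‖ = √(D_s²/4 − 2). -/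
open scoped InnerProductSpace BigOperators

/-- The case where the point `(1, -s)` lies outside the dual ellipse of the pair `x, y`. -/
lemma gram_eq_of_corner_outside {s T R₁ R₂ g : ℝ} (hs1 : 1 ≤ s) (hs2 : s ≤ 2)
    (hT : T ^ 2 = (2 * s ^ 2 + 10) * T - 8 * (1 + s) ^ 2) (hT1 : 2 * s ^ 2 + 4 ≤ T)
    (hT2 : 8 + 2 * (s - 1) ^ 2 ≤ T)
    (h12 : R₁ ≤ R₂) (hR : R₂ ≤ 2 * s) (hg : -2 ≤ g) (hle : T ≤ R₁ + R₂ - 2 * g)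
    (hF : R₁ * R₂ - g ^ 2 ≤ R₂ + 2 * g * s + R₁ * s ^ 2) :
    R₁ = R₂ ∧ g = -2 ∧ R₁ + R₂ - 2 * g = T := by
  obtain ⟨ε, hε⟩ : ∃ ε, ε = R₁ + R₂ - 2 * g - T := ⟨_, rfl⟩
  obtain ⟨γ, hγ⟩ : ∃ γ, γ = g + 2 := ⟨_, rfl⟩
  obtain ⟨d, hd⟩ : ∃ d, d = R₂ - R₁ := ⟨_, rfl⟩
  have hε0 : 0 ≤ ε := by linarith
  have hγ0 : 0 ≤ γ := by linarith
  have hd0 : 0 ≤ d := by linarith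
  obtain rfl : g = γ - 2 := by linarith
  obtain rfl : R₂ = (T + ε) / 2 - 2 + γ + d / 2 := by linarith
  obtain rfl : R₁ = (T + ε) / 2 - 2 + γ - d / 2 := by linarith
  have hdb : d ≤ 4 * s + 4 - T := by linarith
  have hdle : 4 * s + 4 - T ≤ 2 * (s ^ 2 - 1) := by
    by_contra! h
    have h4 : 0 ≤ (T - (6 + 4 * s - 2 * s ^ 2)) * (T + (6 + 4 * s - 2 * s ^ 2) - 2 * s ^ 2 - 10) +
        8 * (s - 1) ^ 2 * (s + 1) * (s - 2) := by nlinarith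
    have h5 : (s - 1) ^ 2 * (s + 1) * (s - 2) ≤ 0 := by
      apply mul_nonpos_of_nonneg_of_nonpos
      · positivity
      · linarith
    nlinarith [sq_nonneg (s - 1)]
  have key : γ * (T - 4 + 3 - 2 * s - s ^ 2) + ε / 2 * ((T - 4) + ε / 2 - 1 - s ^ 2 + 2 * γ) +
      d / 4 * (2 * (s ^ 2 - 1) - d) ≤ 0 := by nlinarith
  have a1 : 0 < T - 4 + 3 - 2 * s - s ^ 2 := by nlinarith
  have a2 : 0 ≤ ε / 2 * ((T - 4) + ε / 2 - 1 - s ^ 2 + 2 * γ) := by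
    apply mul_nonneg (by linarith)
    nlinarith
  have a3 : 0 ≤ d / 4 * (2 * (s ^ 2 - 1) - d) := mul_nonneg (by linarith) (by linarith)
  have a4 : 0 ≤ γ * (T - 4 + 3 - 2 * s - s ^ 2) := by positivity
  have g0 : γ = 0 := by
    have : γ * (T - 4 + 3 - 2 * s - s ^ 2) = 0 := by linarith
    rcases mul_eq_zero.1 this with h | h
    · exact h
    · linarith
  subst g0
  have e0 : ε = 0 := by
    have h : ε / 2 * ((T - 4) + ε / 2 - 1 - s ^ 2 + 2 * 0) ≤ 0 := by linarith
    by_contra hne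
    have hpos : 0 < ε := lt_of_le_of_ne hε0 (Ne.symm hne)
    rcases hs1.lt_or_eq with h1 | h1
    · nlinarith
    · subst h1
      nlinarith
  subst e0
  have d0 : d = 0 := by
    have h : d / 4 * (2 * (s ^ 2 - 1) - d) ≤ 0 := by linarith
    by_contra hne
    have hpos : 0 < d := lt_of_le_of_ne hd0 (Ne.symm hne)
    have h1 : 2 * (s ^ 2 - 1) ≤ d := by
      by_contra! h1
      linarith [mul_pos (by linarith : 0 < d / 4) (by linarith : 0 < 2 * (s ^ 2 - 1) - d)]
    obtain rfl : T = 6 + 4 * s - 2 * s ^ 2 := by linarith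
    have h2 : (s - 1) ^ 2 * ((s + 1) * (s - 2)) = 0 := by linarith
    rcases mul_eq_zero.1 h2 with h3 | h3
    · obtain rfl : s = 1 := by linarith [pow_eq_zero_iff (two_ne_zero) |>.1 h3]
      linarith
    · rcases mul_eq_zero.1 h3 with h3 | h3
      · linarith
      · obtain rfl : s = 2 := by linarith
        linarith
  subst d0
  refine ⟨by ring, by ring, by ring⟩

/-- The points `(1, β)` and `(α, -s)` of the dual ellipse are positively oriented. -/
lemma orientation_pos {s R₁ R₂ g α β : ℝ} (hs1 : 1 ≤ s) (hR1 : 1 < R₁) (h12 : R₁ ≤ R₂) (hR : R₂ ≤ 2 * s) (hg : g < 0)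
    (hP : R₂ - 2 * g * β + R₁ * β ^ 2 = R₁ * R₂ - g ^ 2)
    (hV : R₂ * α ^ 2 + 2 * g * s * α + R₁ * s ^ 2 = R₁ * R₂ - g ^ 2)
    (hβ : -s < β) (hα : α < 1) : 0 < s + α * β := by
  have hR1p : 0 < R₁ := by linarith
  have hR2p : 0 < R₂ := by linarith
  rcases le_or_gt 0 α with h | h
  · nlinarith
  rcases le_or_gt β 0 with h' | h'
  · nlinarith [mul_nonneg_of_nonpos_of_nonpos h.le h']
  have i1 : R₁ * β ^ 2 ≤ R₂ * (R₁ - 1) := by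
    linarith [mul_pos h' (by linarith : 0 < -g), sq_nonneg g]
  have i2 : R₂ * α ^ 2 < R₁ * (R₂ - s ^ 2) := by
    linarith [mul_pos (mul_pos (by linarith : 0 < -α) (by linarith : 0 < -g))
      (by linarith : 0 < s), sq_pos_of_neg hg]
  have i0 : 0 < R₁ * (R₂ - s ^ 2) := lt_of_le_of_lt (by positivity) i2
  have i0' : 0 < R₂ - s ^ 2 := (mul_pos_iff_of_pos_left hR1p).1 i0
  have i3 : (R₁ * β ^ 2) * (R₂ * α ^ 2) < (R₂ * (R₁ - 1)) * (R₁ * (R₂ - s ^ 2)) :=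
    mul_lt_mul' i1 i2 (by positivity) (mul_pos hR2p (by linarith))
  have i4 : R₁ * R₂ * (α * β) ^ 2 < R₁ * R₂ * ((R₁ - 1) * (R₂ - s ^ 2)) := by linarith
  have i5 := lt_of_mul_lt_mul_left i4 (by positivity)
  have i6 : (R₁ - 1) * (R₂ - s ^ 2) ≤ (2 * s - 1) * (2 * s - s ^ 2) := by
    apply mul_le_mul <;> linarith
  have i7 : (2 * s - 1) * (2 * s - s ^ 2) ≤ s ^ 2 := by
    linarith [mul_nonneg (by linarith : 0 ≤ s) (sq_nonneg (s - 1))]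
  linarith [(abs_lt_of_sq_lt_sq' (i5.trans_le (i6.trans i7)) (by linarith)).1]

/-- The law of cosines numerator of `T` is too small once the certificate
`A ≤ 3 - s + 2 * c` holds. -/
lemma numerator_lt {s T c A B : ℝ} (hs1 : 1 ≤ s) (hs2 : s ≤ 2)
    (hT : T ^ 2 = (2 * s ^ 2 + 10) * T - 8 * (1 + s) ^ 2) (hT1 : 2 * s ^ 2 + 4 ≤ T)
    (hT4 : T ≤ 4 * s + 4) (hc2 : -1 < c) (hc1 : c < 1) (hcs : c ≤ s - 1)
    (hA1 : 1 + s * c ≤ A) (hA2 : A ≤ 3 - s + 2 * c) (hA3 : A < 1 + s)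
    (hB2 : s + c ≤ B) (hB1 : B < 1 + s)
    (hR12 : B ^ 2 - 2 * B * (s + c) ≤ A ^ 2 - 2 * A - 2 * c * s * A) :
    A ^ 2 + B ^ 2 - 2 * c * A * B < T * (1 - c ^ 2) := by
  have hcc : 0 < 1 - c ^ 2 := by
    linarith [mul_pos (by linarith : 0 < 1 - c) (by linarith : 0 < 1 + c)]
  have hco : 0 < s + c - c * A := by
    rcases le_or_gt 0 c with h | h
    · linarith [mul_nonneg h (by linarith : 0 ≤ 1 + s - A),
        mul_pos (by linarith : 0 < s) (by linarith : 0 < 1 - c)]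
    · linarith [mul_nonneg (by linarith : 0 ≤ -c) (by linarith : 0 ≤ A - (1 + s * c)),
        mul_pos (by linarith : 0 < s) hcc]
  rcases le_or_gt ((T + 4 - 8 * s) * c + (4 * s ^ 2 - 8 * s + 12 - T)) 0 with hcase | hcase
  · have h1 : A ^ 2 + B ^ 2 - 2 * c * A * B ≤
        2 * A ^ 2 - 2 * A - 2 * c * s * A + 2 * B * (s + c - c * A) := by linarith
    have h2 : 2 * B * (s + c - c * A) < 2 * (1 + s) * (s + c - c * A) := by nlinarith
    have h3 : 0 ≤ A - c * (1 + s) := by linarith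
    have h4 : 2 * A ^ 2 - 2 * A - 2 * c * s * A + 2 * (1 + s) * (s + c - c * A) ≤
        (4 - 8 * s) * c ^ 2 + 4 * (s - 2) ^ 2 * c + (4 * s ^ 2 - 8 * s + 12) := by
      obtain ⟨t, ht⟩ : ∃ t, t = 3 - s + 2 * c - A := ⟨_, rfl⟩
      have ht0 : 0 ≤ t := by linarith
      have : 0 ≤ t * ((A - (1 + s * c)) + (A - c * (1 + s)) + t) := by
        apply mul_nonneg ht0; linarith
      obtain rfl : A = 3 - s + 2 * c - t := by linarith
      linarith
    have h5 : 0 ≤ (1 + c) * -((T + 4 - 8 * s) * c + (4 * s ^ 2 - 8 * s + 12 - T)) :=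
      mul_nonneg (by linarith) (by linarith)
    linarith
  · have hD : 0 < T + 4 - 8 * s := by
      have : 0 ≤ T + 4 - 8 * s := by nlinarith [sq_nonneg (s - 2)]
      rcases this.lt_or_eq with h | h
      · exact h
      · have : (s - 2) ^ 2 ≤ 0 := by nlinarith
        have : s = 2 := by nlinarith
        subst this
        nlinarith
    have hlin : 0 ≤ 4 * (s - 1) - (T - 4 * s) * c := by
      rcases le_or_gt 0 c with h | h <;> nlinarith
    have hq : 0 ≤ T * (1 - c ^ 2) -
        ((3 - s + 2 * c) ^ 2 + (1 + s) ^ 2 - 2 * c * (3 - s + 2 * c) * (1 + s)) := by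
      have h1 := mul_nonneg hcase.le hlin
      have h2 : (T + 4 - 8 * s) * (T * (1 - c ^ 2) -
          ((3 - s + 2 * c) ^ 2 + (1 + s) ^ 2 - 2 * c * (3 - s + 2 * c) * (1 + s))) =
        ((T + 4 - 8 * s) * c + (4 * s ^ 2 - 8 * s + 12 - T)) *
          (4 * (s - 1) - (T - 4 * s) * c) := by
        linear_combination (1 - c) * hT
      rw [← h2] at h1
      exact nonneg_of_mul_nonneg_right h1 hD
    have h3 : A ^ 2 + B ^ 2 - 2 * c * A * B < A ^ 2 + (1 + s) ^ 2 - 2 * c * A * (1 + s) := by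
      linarith [mul_pos (by linarith : 0 < 1 + s - B) (by linarith : 0 < 1 + s + B - 2 * (c * A))]
    have h4 : A ^ 2 + (1 + s) ^ 2 - 2 * c * A * (1 + s) ≤
        (3 - s + 2 * c) ^ 2 + (1 + s) ^ 2 - 2 * c * (3 - s + 2 * c) * (1 + s) := by
      linarith [mul_nonneg (by linarith : 0 ≤ 3 - s + 2 * c - A)
        (by linarith : 0 ≤ 3 - s + 2 * c + A - 2 * (c * (1 + s)))]
    linarith

/-- The case where the point `(1, -s)` lies inside the dual ellipse of the pair `x, y`: here
`(1, β)` and `(α, -s)` are the points of that ellipse ending the arc cut off by the corner. -/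
lemma false_of_corner_inside {s T R₁ R₂ g α β : ℝ} (hs1 : 1 ≤ s) (hs2 : s ≤ 2)
    (hT : T ^ 2 = (2 * s ^ 2 + 10) * T - 8 * (1 + s) ^ 2) (hT1 : 2 * s ^ 2 + 4 ≤ T)
    (hT2 : 8 + 2 * (s - 1) ^ 2 ≤ T)
    (h12 : R₁ ≤ R₂) (hR : R₂ ≤ 2 * s) (hg : -2 ≤ g) (hle : T ≤ R₁ + R₂ - 2 * g)
    (hΔ : 0 < R₁ * R₂ - g ^ 2)
    (hP : R₂ - 2 * g * β + R₁ * β ^ 2 = R₁ * R₂ - g ^ 2)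
    (hV : R₂ * α ^ 2 + 2 * g * s * α + R₁ * s ^ 2 = R₁ * R₂ - g ^ 2)
    (hβr : 0 ≤ R₁ * β - g) (hαr : R₂ * α + g * s ≤ 0) (hβ : -s < β) (hα : α < 1)
    (hM : 0 ≤ 2 * (s + α * β) + (β + s) * g - (1 - α) * R₂) : False := by
  have hR1 : 2 - 2 * (s - 1) + 2 * (s - 1) ^ 2 ≤ R₁ := by linarith
  have hR1' : 1 < R₁ := by nlinarith [sq_nonneg (2 * (s - 1) - 1)]
  have hg0 : g ≤ -1 := by nlinarith [sq_nonneg (s - 1)]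
  have hT4 : T ≤ 4 * s + 4 := by linarith
  have hJ : 0 < s + α * β :=
    orientation_pos hs1 hR1' h12 hR (by linarith) hP hV hβ hα
  obtain ⟨c, hc⟩ : ∃ c, c * (R₁ * R₂ - g ^ 2) =
      R₂ * α - g * (α * β - s) - R₁ * β * s := ⟨_, div_mul_cancel₀ _ hΔ.ne'⟩
  obtain ⟨Δ, hΔe⟩ : ∃ Δ, Δ = R₁ * R₂ - g ^ 2 := ⟨_, rfl⟩
  rw [← hΔe] at hΔ hP hV hc
  have r1 : (1 - c ^ 2) * Δ = (s + α * β) ^ 2 := by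
    apply mul_left_cancel₀ hΔ.ne'
    have : Δ * Δ - (c * Δ) ^ 2 = Δ * (s + α * β) ^ 2 := by
      rw [hc]
      nth_rewrite 1 [← hP]
      nth_rewrite 1 [← hV]
      rw [hΔe]
      ring
    linarith
  have r2 : R₁ * (1 - c ^ 2) = 1 - 2 * c * α + α ^ 2 := by
    apply mul_left_cancel₀ hΔ.ne'
    linear_combination R₁ * r1 + 2 * α * hc + hV + α ^ 2 * hP
  have r3 : R₂ * (1 - c ^ 2) = β ^ 2 + 2 * c * β * s + s ^ 2 := by
    apply mul_left_cancel₀ hΔ.ne'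
    linear_combination R₂ * r1 - 2 * β * s * hc + β ^ 2 * hV + s ^ 2 * hP
  have r4 : g * (1 - c ^ 2) = β - α * s + c * s - c * α * β := by
    apply mul_left_cancel₀ hΔ.ne'
    linear_combination g * r1 - (s - α * β) * hc + β * hV - α * s * hP
  have hcc : 0 < 1 - c ^ 2 := by
    by_contra! h
    linarith [pow_pos hJ 2, mul_nonneg (by linarith : 0 ≤ -(1 - c ^ 2)) hΔ.le]
  obtain ⟨hc2, hc1⟩ := abs_lt.1 ((sq_lt_one_iff_abs_lt_one c).1 (by linarith))
  have b1 : β + s * c ≤ 0 := by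
    have : Δ * (β + s * c) = (R₂ * α + g * s) * (s + α * β) := by
      linear_combination s * hc - β * hV
    by_contra! h
    linarith [mul_pos hΔ h, mul_nonneg (neg_nonneg.2 hαr) hJ.le]
  have b2 : 0 ≤ α - c := by
    have : Δ * (α - c) = (R₁ * β - g) * (s + α * β) := by
      linear_combination -hc - α * hP
    by_contra! h
    linarith [mul_pos hΔ (neg_pos.2 h), mul_nonneg hβr hJ.le]
  have b3 : 0 ≤ 2 * (1 + c) + β - s := by
    have : (2 * (s + α * β) + (β + s) * g - (1 - α) * R₂) * (1 - c ^ 2) =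
        ((s + α * β) * (1 - c)) * (2 * (1 + c) + β - s) := by
      linear_combination (β + s) * r4 - (1 - α) * r3
    have h1 := mul_nonneg hM hcc.le
    rw [this] at h1
    exact nonneg_of_mul_nonneg_right h1 (mul_pos hJ (by linarith))
  have b4 : R₁ * (1 + c) ≤ 2 := by
    have h1 : (α - c) ^ 2 ≤ (1 - c) ^ 2 := by
      apply pow_le_pow_left₀ b2; linarith
    have h2 : (1 - c) * (R₁ * (1 + c)) ≤ (1 - c) * 2 := by linarith
    exact le_of_mul_le_mul_left h2 (by linarith)
  have b5 : c ≤ s - 1 := by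
    by_contra! h
    have : (2 - 2 * (s - 1) + 2 * (s - 1) ^ 2) * (1 + c) ≤ R₁ * (1 + c) :=
      mul_le_mul_of_nonneg_right hR1 (by linarith)
    have h3 : 0 < 2 - 2 * (s - 1) + 2 * (s - 1) ^ 2 := by
      linarith [sq_nonneg (2 * (s - 1) - 1)]
    linarith [pow_nonneg (by linarith : 0 ≤ s - 1) 3,
      mul_pos h3 (by linarith : 0 < c - (s - 1))]
  have hR12 := mul_le_mul_of_nonneg_right h12 hcc.le
  have hnum := numerator_lt (A := 1 - β) (B := α + s) hs1 hs2 hT hT1 hT4 hc2 hc1 b5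
    (by linarith) (by linarith) (by linarith) (by linarith) (by linarith) (by linarith)
  have := mul_le_mul_of_nonneg_right hle hcc.le
  linarith

/-- A point of the dual ellipse in the quadrant `a ≤ 1`, `-s ≤ b` is not separated from the
origin by the chord between `(1, β)` and `(α, -s)`, provided the corner lies inside. -/
lemma chord_nonneg {s R₁ R₂ g Δ α β a b : ℝ} (hR2 : 0 < R₂) (hdet : 0 < R₁ * R₂ - g ^ 2)
    (hF : R₂ + 2 * g * s + R₁ * s ^ 2 < Δ)
    (hP : R₂ - 2 * g * β + R₁ * β ^ 2 = Δ)
    (hV : R₂ * α ^ 2 + 2 * g * s * α + R₁ * s ^ 2 = Δ)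
    (hβ : -s < β) (hα : α < 1) (ha : a ≤ 1) (hb : -s ≤ b)
    (hE : R₂ * a ^ 2 - 2 * g * a * b + R₁ * b ^ 2 = Δ) :
    0 ≤ (β + s) * (1 - a) + (1 - α) * (b - β) := by
  by_contra! h
  obtain ⟨μ, hμ⟩ : ∃ μ, μ * (β + s) = b + s := ⟨_, div_mul_cancel₀ _ (by linarith)⟩
  obtain ⟨ν, hν⟩ : ∃ ν, ν * (1 - α) = 1 - a := ⟨_, div_mul_cancel₀ _ (by linarith)⟩
  have hμ0 : 0 ≤ μ := by
    by_contra! h'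
    linarith [mul_pos (neg_pos.2 h') (by linarith : 0 < β + s)]
  have hν0 : 0 ≤ ν := by
    by_contra! h'
    linarith [mul_pos (neg_pos.2 h') (by linarith : 0 < 1 - α)]
  have hμν : μ + ν < 1 := by
    have h1 : (β + s) * (1 - α) * (μ + ν - 1) < 0 := by
      have : (β + s) * (1 - α) * (μ + ν - 1) =
          (β + s) * (1 - a) + (1 - α) * (b - β) := by
        linear_combination (1 - α) * hμ + (β + s) * hν
      rwa [this]
    by_contra! h'
    linarith [mul_nonneg (mul_pos (by linarith : 0 < β + s) (by linarith : 0 < 1 - α)).le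
      (by linarith : 0 ≤ μ + ν - 1)]
  obtain rfl : b = μ * (β + s) - s := by linarith
  obtain rfl : a = 1 - ν * (1 - α) := by linarith
  have hQ : ∀ p q : ℝ, 0 ≤ R₂ * p ^ 2 - 2 * g * p * q + R₁ * q ^ 2 := by
    intro p q
    refine (mul_nonneg_iff_of_pos_left hR2).1 ?_
    linarith [sq_nonneg (R₂ * p - g * q), mul_nonneg hdet.le (sq_nonneg q)]
  have h1 := mul_nonneg (mul_nonneg hμ0 hν0) (hQ (1 - α) (β + s))
  have h2 := mul_nonneg (mul_nonneg (by linarith : 0 ≤ 1 - μ - ν) hμ0) (hQ 0 (β + s))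
  have h3 := mul_nonneg (mul_nonneg (by linarith : 0 ≤ 1 - μ - ν) hν0) (hQ (1 - α) 0)
  have h4 := mul_pos (by linarith : 0 < 1 - μ - ν)
    (by linarith : 0 < Δ - (R₂ + 2 * g * s + R₁ * s ^ 2))
  have e1 : 0 = μ * (R₂ - 2 * g * β + R₁ * β ^ 2 - Δ) := by rw [hP]; ring
  have e2 : 0 = ν * (R₂ * α ^ 2 + 2 * g * s * α + R₁ * s ^ 2 - Δ) := by rw [hV]; ring
  linarith

/-- Two vectors, given by their Gram matrix and by their inner products `a i`, `b i` with the
vectors of a John decomposition, at distance at least `√T`. -/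
lemma gram_eq_of_le {m : ℕ} {lam a b : Fin m → ℝ} {s T R₁ R₂ g : ℝ}
    (hlam : ∀ i, 0 < lam i) (h0 : ∑ i, lam i = 2)
    (ha0 : ∑ i, lam i * a i = 0) (hb0 : ∑ i, lam i * b i = 0)
    (hab : ∑ i, lam i * (a i * b i) = g) (hbb : ∑ i, lam i * (b i * b i) = R₂)
    (hE : ∀ i, R₂ * a i ^ 2 - 2 * g * a i * b i + R₁ * b i ^ 2 = R₁ * R₂ - g ^ 2)
    (ha1 : ∀ i, a i ≤ 1) (hb1 : ∀ i, b i ≤ 1) (hbs : ∀ i, -s ≤ b i)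
    (hs1 : 1 ≤ s) (hs2 : s ≤ 2)
    (hT : T ^ 2 = (2 * s ^ 2 + 10) * T - 8 * (1 + s) ^ 2) (hT1 : 2 * s ^ 2 + 4 ≤ T)
    (hT2 : 8 + 2 * (s - 1) ^ 2 ≤ T) (h12 : R₁ ≤ R₂) (hle : T ≤ R₁ + R₂ - 2 * g) :
    R₁ = R₂ ∧ g = -2 ∧ R₁ + R₂ - 2 * g = T := by
  have hR : R₂ ≤ 2 * s := by
    have h1 : 0 ≤ ∑ i, lam i * ((1 - b i) * (s + b i)) :=
      Finset.sum_nonneg fun i _ => mul_nonneg (hlam i).le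
        (mul_nonneg (by linarith [hb1 i]) (by linarith [hbs i]))
    have h2 : ∑ i, lam i * ((1 - b i) * (s + b i)) =
        s * ∑ i, lam i + (1 - s) * ∑ i, lam i * b i - ∑ i, lam i * (b i * b i) := by
      simp only [Finset.mul_sum, ← Finset.sum_add_distrib, ← Finset.sum_sub_distrib]
      exact Finset.sum_congr rfl fun i _ => by ring
    rw [h2, h0, hb0, hbb] at h1
    linarith
  have hg : -2 ≤ g := by
    have h1 : 0 ≤ ∑ i, lam i * ((1 - a i) * (1 - b i)) :=
      Finset.sum_nonneg fun i _ => mul_nonneg (hlam i).le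
        (mul_nonneg (by linarith [ha1 i]) (by linarith [hb1 i]))
    have h2 : ∑ i, lam i * ((1 - a i) * (1 - b i)) =
        ∑ i, lam i - ∑ i, lam i * a i - ∑ i, lam i * b i + ∑ i, lam i * (a i * b i) := by
      simp only [← Finset.sum_add_distrib, ← Finset.sum_sub_distrib]
      exact Finset.sum_congr rfl fun i _ => by ring
    rw [h2, h0, ha0, hb0, hab] at h1
    linarith
  rcases le_or_gt (R₁ * R₂ - g ^ 2) (R₂ + 2 * g * s + R₁ * s ^ 2) with hF | hF
  · exact gram_eq_of_corner_outside hs1 hs2 hT hT1 hT2 h12 hR hg hle hF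
  exfalso
  have hR1 : 1 < R₁ := by linarith [sq_nonneg (2 * (s - 1) - 1)]
  have hΔ : 0 < R₁ * R₂ - g ^ 2 := by
    have h1 := mul_pos (by linarith : 0 < R₁) (sub_pos.2 hF)
    have h2 : 0 < (R₁ - 1) * (R₁ * R₂ - g ^ 2) := by linarith [sq_nonneg (R₁ * s + g)]
    exact (mul_pos_iff_of_pos_left (by linarith)).1 h2
  have hsR : s ^ 2 ≤ R₂ := by linarith
  have hg0 : g ≤ -1 := by linarith [sq_nonneg (s - 1)]
  have hR1p : 0 < R₁ := by linarith
  have hR2p : 0 < R₂ := by linarith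
  obtain ⟨β, hβr, hP⟩ : ∃ β, 0 ≤ R₁ * β - g ∧
      R₂ - 2 * g * β + R₁ * β ^ 2 = R₁ * R₂ - g ^ 2 := by
    obtain ⟨w, hw0, hw⟩ : ∃ w, 0 ≤ w ∧ w ^ 2 = (R₁ - 1) * (R₁ * R₂ - g ^ 2) :=
      ⟨_, Real.sqrt_nonneg _, Real.sq_sqrt (mul_nonneg (by linarith) hΔ.le)⟩
    refine ⟨(g + w) / R₁, ?_, ?_⟩
    · rw [mul_div_cancel₀ _ hR1p.ne']
      linarith
    · field_simp
      linear_combination hw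
  obtain ⟨α, hαr, hV⟩ : ∃ α, R₂ * α + g * s ≤ 0 ∧
      R₂ * α ^ 2 + 2 * g * s * α + R₁ * s ^ 2 = R₁ * R₂ - g ^ 2 := by
    obtain ⟨w, hw0, hw⟩ : ∃ w, 0 ≤ w ∧ w ^ 2 = (R₂ - s ^ 2) * (R₁ * R₂ - g ^ 2) :=
      ⟨_, Real.sqrt_nonneg _, Real.sq_sqrt (mul_nonneg (by linarith) hΔ.le)⟩
    refine ⟨(-(g * s) - w) / R₂, ?_, ?_⟩
    · rw [mul_div_cancel₀ _ hR2p.ne']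
      linarith
    · field_simp
      linear_combination hw
  have hβ : -s < β := by
    by_contra! h
    have h1 : 0 ≤ R₁ * (β - s) - 2 * g := by
      linarith [mul_nonneg hR1p.le (by linarith : 0 ≤ -s - β)]
    linarith [mul_nonneg (by linarith : 0 ≤ -s - β) h1]
  have hα : α < 1 := by
    by_contra! h
    have h1 : 0 ≤ -(R₂ * (α + 1) + 2 * g * s) := by
      linarith [mul_nonneg hR2p.le (by linarith : 0 ≤ α - 1)]
    linarith [mul_nonneg (by linarith : 0 ≤ α - 1) h1]
  refine false_of_corner_inside hs1 hs2 hT hT1 hT2 h12 hR hg hle hΔ hP hV hβr hαr hβ hα ?_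
  have h1 : 0 ≤ ∑ i, lam i * ((1 - b i) * ((β + s) * (1 - a i) + (1 - α) * (b i - β))) :=
    Finset.sum_nonneg fun i _ => mul_nonneg (hlam i).le (mul_nonneg (by linarith [hb1 i])
      (chord_nonneg hR2p hΔ hF hP hV hβ hα (ha1 i) (hbs i) (hE i)))
  have h2 : ∑ i, lam i * ((1 - b i) * ((β + s) * (1 - a i) + (1 - α) * (b i - β))) =
      (s + α * β) * ∑ i, lam i - (β + s) * ∑ i, lam i * a i
        + (1 - α - (s + α * β)) * ∑ i, lam i * b i
        + (β + s) * ∑ i, lam i * (a i * b i) - (1 - α) * ∑ i, lam i * (b i * b i) := by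
    simp only [Finset.mul_sum, ← Finset.sum_add_distrib, ← Finset.sum_sub_distrib]
    exact Finset.sum_congr rfl fun i _ => by ring
  rw [h2, h0, ha0, hb0, hab, hbb] at h1
  linarith

/-- The Gram identity satisfied by a unit vector of the plane. -/
lemma gram_identity_of_norm_one {x y u : EuclideanSpace ℝ (Fin 2)} (hu : ‖u‖ = 1) :
    ‖y‖ ^ 2 * ⟪u, x⟫_ℝ ^ 2 - 2 * ⟪x, y⟫_ℝ * ⟪u, x⟫_ℝ * ⟪u, y⟫_ℝ + ‖x‖ ^ 2 * ⟪u, y⟫_ℝ ^ 2 =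
      ‖x‖ ^ 2 * ‖y‖ ^ 2 - ⟪x, y⟫_ℝ ^ 2 := by
  have h : ‖u‖ ^ 2 = 1 := by rw [hu, one_pow]
  simp only [EuclideanSpace.real_norm_sq_eq, PiLp.inner_apply, Fin.sum_univ_two,
    RCLike.inner_apply, conj_trivial] at h ⊢
  linear_combination (x 0 * y 1 - x 1 * y 0) ^ 2 * h

/-- The weights of a planar John decomposition sum up to two. -/
lemma sum_weights_eq_two {m : ℕ} {u : Fin m → EuclideanSpace ℝ (Fin 2)} {lam : Fin m → ℝ}
    (hu : ∀ i, ‖u i‖ = 1)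
    (h : ∀ z w : EuclideanSpace ℝ (Fin 2), ∑ i, lam i * (⟪u i, z⟫_ℝ * ⟪u i, w⟫_ℝ) = ⟪z, w⟫_ℝ) :
    ∑ i, lam i = 2 := by
  have h0 := h (EuclideanSpace.single 0 1) (EuclideanSpace.single 0 1)
  have h1 := h (EuclideanSpace.single 1 1) (EuclideanSpace.single 1 1)
  have h2 : ∑ i, lam i = ∑ i, lam i * (u i 0 * u i 0) + ∑ i, lam i * (u i 1 * u i 1) := by
    rw [← Finset.sum_add_distrib]
    refine Finset.sum_congr rfl fun i _ => ?_
    have h3 : ‖u i‖ ^ 2 = 1 := by rw [hu, one_pow]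
    rw [EuclideanSpace.real_norm_sq_eq, Fin.sum_univ_two] at h3
    linear_combination -lam i * h3
  simp [EuclideanSpace.inner_single_right] at h0 h1
  linarith

/-- The properties of the squared diameter bound `D_s ^ 2`. -/
lemma diameter_sq_bounds {s T : ℝ} (hs1 : 1 ≤ s)
    (hT : T = s ^ 2 + 5 + √(4 * (2 - s) ^ 2 + (s ^ 2 - 1) ^ 2)) :
    T ^ 2 = (2 * s ^ 2 + 10) * T - 8 * (1 + s) ^ 2 ∧ 2 * s ^ 2 + 4 ≤ T ∧
      8 + 2 * (s - 1) ^ 2 ≤ T := by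
  obtain ⟨w, hw⟩ : ∃ w, w = √(4 * (2 - s) ^ 2 + (s ^ 2 - 1) ^ 2) := ⟨_, rfl⟩
  have hw2 : w ^ 2 = 4 * (2 - s) ^ 2 + (s ^ 2 - 1) ^ 2 := by
    rw [hw]
    exact Real.sq_sqrt (by positivity)
  rw [← hw] at hT
  subst hT
  refine ⟨by linear_combination hw2, ?_, ?_⟩
  · have : s ^ 2 - 1 ≤ w := hw ▸ Real.le_sqrt_of_sq_le (by linarith [sq_nonneg (2 - s)])
    linarith
  · have : 5 - 4 * s + s ^ 2 ≤ w := by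
      refine hw ▸ Real.le_sqrt_of_sq_le ?_
      linarith [pow_nonneg (sub_nonneg.2 hs1) 3]
    linarith

/-- the planar diameter bound in terms of the John asymmetry,
with its equality characterization. -/
theorem stmt8 (K : Set (EuclideanSpace ℝ (Fin 2)))
    (hKcompact : IsCompact K) (hKconv : Convex ℝ K) (hKint : (interior K).Nonempty)
    (hBK : Metric.closedBall 0 1 ⊆ K)
    (m : ℕ) (u : Fin m → EuclideanSpace ℝ (Fin 2)) (lam : Fin m → ℝ)
    (hu : ∀ i, ‖u i‖ = 1) (hlam : ∀ i, 0 < lam i)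
    (huK : ∀ i, u i ∈ K)
    (hsum : ∑ i, lam i • u i = 0)
    (hdecomp : ∀ x : EuclideanSpace ℝ (Fin 2), ∑ i, (lam i * ⟪u i, x⟫_ℝ) • u i = x)
    (hsupp : ∀ x ∈ K, ∀ i, ⟪x, u i⟫_ℝ ≤ 1)
    (s : ℝ) (hs1 : 1 ≤ s) (hs2 : s ≤ 2)
    (hsleast : IsLeast {ρ : ℝ | 0 < ρ ∧ ∀ x ∈ K, -(ρ⁻¹ • x) ∈ K} s)
    (Ds : ℝ)
    (hDs : Ds = Real.sqrt (s ^ 2 + 5 + Real.sqrt (4 * (2 - s) ^ 2 + (s ^ 2 - 1) ^ 2))) :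
    (∀ x ∈ K, ∀ y ∈ K, ‖x - y‖ ≤ Ds) ∧
    ∀ x ∈ K, ∀ y ∈ K, (‖x - y‖ = Ds ↔
      ‖x‖ = Real.sqrt (Ds ^ 2 / 2 - 2) ∧ ‖y‖ = Real.sqrt (Ds ^ 2 / 2 - 2) ∧
      ‖(2⁻¹ : ℝ) • (x + y)‖ = Real.sqrt (Ds ^ 2 / 4 - 2)) := by
  have hinner : ∀ z w : EuclideanSpace ℝ (Fin 2),
      ∑ i, lam i * (⟪u i, z⟫_ℝ * ⟪u i, w⟫_ℝ) = ⟪z, w⟫_ℝ := by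
    intro z w
    conv_rhs => rw [← hdecomp z, sum_inner]
    exact Finset.sum_congr rfl fun i _ => by rw [real_inner_smul_left]; ring
  have hcenter : ∀ z : EuclideanSpace ℝ (Fin 2), ∑ i, lam i * ⟪u i, z⟫_ℝ = 0 := by
    intro z
    have h := congrArg (fun v => ⟪v, z⟫_ℝ) hsum
    simpa only [sum_inner, real_inner_smul_left, inner_zero_left] using h
  have hupper : ∀ z ∈ K, ∀ i, ⟪u i, z⟫_ℝ ≤ 1 := fun z hz i => by
    rw [real_inner_comm]
    exact hsupp z hz i
  have hlower : ∀ z ∈ K, ∀ i, -s ≤ ⟪u i, z⟫_ℝ := by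
    intro z hz i
    have h := hupper _ (hsleast.1.2 z hz) i
    rw [inner_neg_right, real_inner_smul_right, neg_le, ← div_eq_inv_mul,
      le_div_iff₀ hsleast.1.1] at h
    linarith
  obtain ⟨T, hTe⟩ : ∃ T, T = s ^ 2 + 5 + √(4 * (2 - s) ^ 2 + (s ^ 2 - 1) ^ 2) := ⟨_, rfl⟩
  obtain ⟨hT, hT1, hT2⟩ := diameter_sq_bounds hs1 hTe
  rw [← hTe] at hDs
  have hT0 : 0 ≤ T := by linarith [sq_nonneg (s - 1)]
  have hD2 : Ds ^ 2 = T := by rw [hDs, Real.sq_sqrt hT0]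
  have hD0 : 0 ≤ Ds := hDs ▸ Real.sqrt_nonneg T
  have hsub : ∀ x y : EuclideanSpace ℝ (Fin 2),
      ‖x - y‖ ^ 2 = ‖x‖ ^ 2 + ‖y‖ ^ 2 - 2 * ⟪x, y⟫_ℝ := fun x y => by
    rw [norm_sub_sq_real]; ring
  have hmain : ∀ x ∈ K, ∀ y ∈ K, T ≤ ‖x - y‖ ^ 2 →
      ‖x‖ ^ 2 = ‖y‖ ^ 2 ∧ ⟪x, y⟫_ℝ = -2 ∧ ‖x - y‖ ^ 2 = T := by
    have hordered : ∀ x ∈ K, ∀ y ∈ K, ‖x‖ ^ 2 ≤ ‖y‖ ^ 2 → T ≤ ‖x - y‖ ^ 2 →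
        ‖x‖ ^ 2 = ‖y‖ ^ 2 ∧ ⟪x, y⟫_ℝ = -2 ∧ ‖x - y‖ ^ 2 = T := by
      intro x hx y hy hxy hle
      rw [hsub] at hle ⊢
      exact gram_eq_of_le hlam (sum_weights_eq_two hu hinner) (hcenter x) (hcenter y)
        (hinner x y) ((hinner y y).trans (real_inner_self_eq_norm_sq y))
        (fun i => gram_identity_of_norm_one (hu i)) (hupper x hx) (hupper y hy) (hlower y hy)
        hs1 hs2 hT hT1 hT2 hxy hle
    intro x hx y hy hle
    rcases le_total (‖x‖ ^ 2) (‖y‖ ^ 2) with h | h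
    · exact hordered x hx y hy h hle
    · rw [norm_sub_rev] at hle ⊢
      obtain ⟨h1, h2, h3⟩ := hordered y hy x hx h hle
      exact ⟨h1.symm, (real_inner_comm y x).trans h2, h3⟩
  have hmid : ∀ x y : EuclideanSpace ℝ (Fin 2),
      ‖(2⁻¹ : ℝ) • (x + y)‖ ^ 2 = (‖x‖ ^ 2 + ‖y‖ ^ 2 + 2 * ⟪x, y⟫_ℝ) / 4 := by
    intro x y
    rw [norm_smul, mul_pow, norm_add_sq_real, Real.norm_eq_abs, sq_abs]
    ring
  refine ⟨fun x hx y hy => ?_, fun x hx y hy => ⟨fun h => ?_, fun ⟨h1, h2, h3⟩ => ?_⟩⟩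
  · by_contra! h
    have h1 : Ds ^ 2 < ‖x - y‖ ^ 2 := pow_lt_pow_left₀ h hD0 two_ne_zero
    rw [hD2] at h1
    exact h1.ne' (hmain x hx y hy h1.le).2.2
  · have hsq : ‖x - y‖ ^ 2 = T := by rw [h, hD2]
    obtain ⟨h1, h2, -⟩ := hmain x hx y hy hsq.ge
    rw [hsub, h2] at hsq
    rw [hD2]
    refine ⟨?_, ?_, ?_⟩
    · rw [← Real.sqrt_sq (norm_nonneg x)]
      congr 1
      linarith
    · rw [← Real.sqrt_sq (norm_nonneg y)]
      congr 1
      linarith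
    · rw [← Real.sqrt_sq (norm_nonneg ((2⁻¹ : ℝ) • (x + y))), hmid]
      congr 1
      linarith
  · rw [hD2] at h1 h2 h3
    have e1 : ‖x‖ ^ 2 = T / 2 - 2 := by
      rw [h1, Real.sq_sqrt (by linarith [sq_nonneg (s - 1)])]
    have e2 : ‖y‖ ^ 2 = T / 2 - 2 := by
      rw [h2, Real.sq_sqrt (by linarith [sq_nonneg (s - 1)])]
    have e3 : ‖(2⁻¹ : ℝ) • (x + y)‖ ^ 2 = T / 4 - 2 := by
      rw [h3, Real.sq_sqrt (by linarith [sq_nonneg (s - 1)])]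
    rw [hmid] at e3
    rw [hDs, ← Real.sqrt_sq (norm_nonneg (x - y)), hsub]
    congr 1
    linarith
end

section
/- Let n ≥ 1 and let K ⊆ ℝⁿ be a convex body with Bⁿ ⊆ K admitting a John decomposition u¹,…,uᵐ, λ₁,…,λₘ with every uᵢ ∈ K and ⟨x,uᵢ⟩ ≤ 1 for all x ∈ K and all i (i.e., Bⁿ is the John ellipsoid of K). Let s ≥ 1 be the least ρ > 0 such that −(1/ρ)·x ∈ K for every x ∈ K (the John asymmetry of K). Then: (a) K ⊆ √(n·s)·Bⁿ, i.e., ‖x‖ ≤ √(n·s) for every x ∈ K; and (b) for every ρ ≥ 0 with K ⊆ ρ·Bⁿ one has s ≤ ρ. -/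
open scoped InnerProductSpace BigOperators

/-- The weights of a decomposition of the identity by unit vectors sum to the dimension. -/
theorem sum_weights_eq_dim {n m : ℕ} (u : Fin m → EuclideanSpace ℝ (Fin n)) (lam : Fin m → ℝ)
    (hu : ∀ i, ‖u i‖ = 1)
    (hdecomp : ∀ x : EuclideanSpace ℝ (Fin n), ∑ i, (lam i * ⟪u i, x⟫_ℝ) • u i = x) :
    ∑ i, lam i = n := by
  let b := EuclideanSpace.basisFun (Fin n) ℝ
  have hcoord : ∀ j, ∑ i, lam i * (⟪u i, b j⟫_ℝ * ⟪b j, u i⟫_ℝ) = 1 := by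
    intro j
    have h := congrArg (fun y => ⟪b j, y⟫_ℝ) (hdecomp (b j))
    simp only [inner_sum, real_inner_smul_right, real_inner_self_eq_norm_sq,
      b.orthonormal.1 j] at h
    simpa [mul_assoc] using h
  calc ∑ i, lam i = ∑ i, ∑ j, lam i * (⟪u i, b j⟫_ℝ * ⟪b j, u i⟫_ℝ) := by
        refine Finset.sum_congr rfl fun i _ => ?_
        rw [← Finset.mul_sum, b.sum_inner_mul_inner, real_inner_self_eq_norm_sq, hu i]
        ring
    _ = ∑ j : Fin n, (1 : ℝ) := by
        rw [Finset.sum_comm]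
        exact Finset.sum_congr rfl fun j _ => hcoord j
    _ = n := by simp

/-- A point whose inner products with the vectors of a John decomposition all lie in `[-s, 1]`
has norm at most `√(n s)`. -/
theorem norm_le_sqrt_of_inner_mem_Icc {n m : ℕ} (u : Fin m → EuclideanSpace ℝ (Fin n))
    (lam : Fin m → ℝ) (hu : ∀ i, ‖u i‖ = 1) (hlam : ∀ i, 0 < lam i)
    (hsum : ∑ i, lam i • u i = 0)
    (hdecomp : ∀ x : EuclideanSpace ℝ (Fin n), ∑ i, (lam i * ⟪u i, x⟫_ℝ) • u i = x)
    {s : ℝ} {x : EuclideanSpace ℝ (Fin n)} (hx : ∀ i, ⟪x, u i⟫_ℝ ∈ Set.Icc (-s) 1) :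
    ‖x‖ ≤ √(n * s) := by
  have hlin : ∑ i, lam i * ⟪x, u i⟫_ℝ = 0 := by
    have h := congrArg (fun y => ⟪x, y⟫_ℝ) hsum
    simpa only [inner_sum, real_inner_smul_right, inner_zero_right] using h
  have hquad : ∑ i, lam i * ⟪x, u i⟫_ℝ ^ 2 = ‖x‖ ^ 2 := by
    have h := congrArg (fun y => ⟪x, y⟫_ℝ) (hdecomp x)
    simp only [inner_sum, real_inner_smul_right, real_inner_self_eq_norm_sq] at h
    rw [← h]
    refine Finset.sum_congr rfl fun i _ => ?_
    rw [real_inner_comm x (u i)]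
    ring
  have hnonneg : 0 ≤ ∑ i, lam i * ((1 - ⟪x, u i⟫_ℝ) * (s + ⟪x, u i⟫_ℝ)) :=
    Finset.sum_nonneg fun i _ => mul_nonneg (hlam i).le
      (mul_nonneg (by linarith [(hx i).2]) (by linarith [(hx i).1]))
  have hexpand : ∑ i, lam i * ((1 - ⟪x, u i⟫_ℝ) * (s + ⟪x, u i⟫_ℝ)) =
      s * ∑ i, lam i + (1 - s) * ∑ i, lam i * ⟪x, u i⟫_ℝ - ∑ i, lam i * ⟪x, u i⟫_ℝ ^ 2 := by
    rw [Finset.mul_sum, Finset.mul_sum, ← Finset.sum_add_distrib, ← Finset.sum_sub_distrib]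
    exact Finset.sum_congr rfl fun i _ => by ring
  rw [hexpand, sum_weights_eq_dim u lam hu hdecomp, hlin, hquad] at hnonneg
  exact Real.le_sqrt_of_sq_le (by linarith)

/-- the sharpened John-rounding bounds in terms of the John
asymmetry: `s_J(K) ≤ ρ ≤ √(n s_J(K))` for the smallest origin-centered ball
`ρ Bⁿ` containing a body `K` in John position. -/
theorem stmt12 (n : ℕ) (hn : 1 ≤ n)
    (K : Set (EuclideanSpace ℝ (Fin n)))
    (hKcompact : IsCompact K) (hKconv : Convex ℝ K) (hKint : (interior K).Nonempty)
    (hBK : Metric.closedBall 0 1 ⊆ K)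
    (m : ℕ) (u : Fin m → EuclideanSpace ℝ (Fin n)) (lam : Fin m → ℝ)
    (hu : ∀ i, ‖u i‖ = 1) (hlam : ∀ i, 0 < lam i)
    (huK : ∀ i, u i ∈ K)
    (hsum : ∑ i, lam i • u i = 0)
    (hdecomp : ∀ x : EuclideanSpace ℝ (Fin n), ∑ i, (lam i * ⟪u i, x⟫_ℝ) • u i = x)
    (hsupp : ∀ x ∈ K, ∀ i, ⟪x, u i⟫_ℝ ≤ 1)
    (s : ℝ) (hs : 1 ≤ s)
    (hsleast : IsLeast {ρ : ℝ | 0 < ρ ∧ ∀ x ∈ K, -(ρ⁻¹ • x) ∈ K} s) :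
    (∀ x ∈ K, ‖x‖ ≤ Real.sqrt ((n : ℝ) * s)) ∧
    (∀ ρ : ℝ, 0 ≤ ρ → K ⊆ Metric.closedBall 0 ρ → s ≤ ρ) := by
  obtain ⟨⟨hs0, hsK⟩, hsmin⟩ := hsleast
  refine ⟨fun x hx => ?_, fun ρ _ hKρ => ?_⟩
  · refine norm_le_sqrt_of_inner_mem_Icc u lam hu hlam hsum hdecomp fun i => ⟨?_, hsupp x hx i⟩
    have h := hsupp _ (hsK x hx) i
    rw [inner_neg_left, real_inner_smul_left, neg_le, le_inv_mul_iff₀ hs0] at h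
    linarith
  · have hρ : 1 ≤ ρ := by
      let e : EuclideanSpace ℝ (Fin n) := EuclideanSpace.single ⟨0, hn⟩ 1
      have he : ‖e‖ = 1 := by simp [e]
      have h := hKρ (hBK (mem_closedBall_zero_iff.2 he.le))
      rwa [mem_closedBall_zero_iff, he] at h
    have hρ0 : 0 < ρ := by linarith
    refine hsmin ⟨hρ0, fun x hx => hBK ?_⟩
    rw [mem_closedBall_zero_iff, norm_neg, norm_smul, norm_inv, Real.norm_of_nonneg hρ0.le,
      inv_mul_le_iff₀ hρ0, mul_one]
    exact mem_closedBall_zero_iff.1 (hKρ hx)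
end

section
/- Let n ≥ 1 and let K ⊆ ℝⁿ be a convex body. Then there exist an invertible affine map A : ℝⁿ → ℝⁿ, a point c ∈ ℝⁿ and a radius ρ > 0 such that the closed ball of radius ρ centered at c is contained in A(K) and the Euclidean diameter of A(K) satisfies diam(A(K)) ≤ √(2n(n+1))·ρ (equivalently, the minimum over invertible affine images of the diameter-to-inradius ratio D/2r is at most √(n(n+1)/2)). Moreover, if K is not a simplex (i.e., K is not the convex hull of n+1 affinely independent points), then A, c, ρ can be chosen so that additionally diam(A(K)) < √(2n(n+1))·ρ. -/
open scoped InnerProductSpace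

section JohnPosition

open Metric Set Filter Topology

variable {E : Type*} [NormedAddCommGroup E] [InnerProductSpace ℝ E]

/-- The closed unit ball is an ellipsoid of maximal volume among those contained in `K`. -/
def IsJohnPosition (K : Set E) : Prop :=
  closedBall (0 : E) 1 ⊆ K ∧
    ∀ (T : E →L[ℝ] E) (c : E), (∀ u ∈ closedBall (0 : E) 1, T u + c ∈ K) → |T.det| ≤ 1

/-- The unit vectors `u` such that `K` lies in the half-space `⟪u, y⟫ ≤ 1`. -/
def unitContacts (K : Set E) : Set E :=
  {u | ‖u‖ = 1 ∧ ∀ y ∈ K, ⟪u, y⟫_ℝ ≤ 1}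

variable [FiniteDimensional ℝ E]

lemma isCompact_unitContacts (K : Set E) : IsCompact (unitContacts K) := by
  refine (isCompact_sphere (0 : E) 1).of_isClosed_subset ?_ fun u hu => by simpa using hu.1
  have : unitContacts K = {u : E | ‖u‖ = 1} ∩ ⋂ y ∈ K, {u | ⟪u, y⟫_ℝ ≤ 1} := by
    ext u; simp [unitContacts]
  rw [this]
  refine (isClosed_eq continuous_norm continuous_const).inter ?_
  exact isClosed_biInter fun y _ => isClosed_le (by fun_prop) continuous_const

/-- A point outside a nonempty closed convex set is separated from it by a unit vector. -/
lemma exists_unit_inner_lt_of_notMem {K : Set E} (hconv : Convex ℝ K) (hcl : IsClosed K)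
    (hne : K.Nonempty) {p : E} (hp : p ∉ K) :
    ∃ v ∈ sphere (0 : E) 1, ∀ y ∈ K, ⟪v, y⟫_ℝ < ⟪v, p⟫_ℝ := by
  obtain ⟨f, r, hf, hr⟩ := geometric_hahn_banach_closed_point hconv hcl hp
  set w : E := (InnerProductSpace.toDual ℝ E).symm f with hw
  have hfw : ∀ y, f y = ⟪w, y⟫_ℝ := fun y => by simp [hw]
  obtain ⟨y₀, hy₀⟩ := hne
  have hw0 : w ≠ 0 := by
    intro h
    have := (hf y₀ hy₀).trans hr
    simp [hfw, h] at this
  have hpos : 0 < ‖w‖ := norm_pos_iff.2 hw0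
  refine ⟨‖w‖⁻¹ • w, by simp [norm_smul, hpos.ne'], fun y hy => ?_⟩
  rw [real_inner_smul_left, real_inner_smul_left, ← hfw, ← hfw]
  exact mul_lt_mul_of_pos_left ((hf y hy).trans hr) (inv_pos.2 hpos)

/-- Every convex body has an affine preimage in John position. -/
lemma exists_affineEquiv_isJohnPosition {K : Set E} (hK : IsCompact K)
    (hint : (interior K).Nonempty) : ∃ B : E ≃ᵃ[ℝ] E, IsJohnPosition (B ⁻¹' K) := by
  let S : Set ((E →L[ℝ] E) × E) := {p | ∀ u ∈ closedBall (0 : E) 1, p.1 u + p.2 ∈ K}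
  have hScl : IsClosed S := by
    have : S = ⋂ u ∈ closedBall (0 : E) 1, {p : (E →L[ℝ] E) × E | p.1 u + p.2 ∈ K} := by
      ext p; simp [S]
    rw [this]
    refine isClosed_biInter fun u _ => hK.isClosed.preimage ?_
    fun_prop
  obtain ⟨R, hR⟩ := hK.isBounded.exists_norm_le
  have hSbdd : S ⊆ closedBall (0 : E →L[ℝ] E) (2 * R) ×ˢ closedBall (0 : E) R := by
    rintro ⟨T, c⟩ hp
    have hc : ‖c‖ ≤ R := by simpa using hR _ (hp 0 (by simp))
    have hR0 : 0 ≤ R := (norm_nonneg _).trans hc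
    refine ⟨?_, by simpa using hc⟩
    rw [mem_closedBall_zero_iff]
    refine ContinuousLinearMap.opNorm_le_of_unit_norm (by positivity) fun x hx => ?_
    have h1 := hR _ (hp x (by simp [hx]))
    have h2 : T x = (T x + c) - c := by abel
    rw [h2]
    exact (norm_sub_le _ _).trans (by simp only at h1; linarith)
  have : ProperSpace (E →L[ℝ] E) := FiniteDimensional.proper ℝ _
  have hScomp : IsCompact S :=
    ((isCompact_closedBall _ _).prod (isCompact_closedBall _ _)).of_isClosed_subset hScl hSbdd
  obtain ⟨c₀, hc₀⟩ := hint
  obtain ⟨r, hr, hball⟩ := nhds_basis_closedBall.mem_iff.1 (mem_interior_iff_mem_nhds.1 hc₀)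
  have hS₀ : (r • ContinuousLinearMap.id ℝ E, c₀) ∈ S := by
    intro u hu
    apply hball
    have : ‖u‖ ≤ 1 := by simpa using hu
    simp only [mem_closedBall, dist_eq_norm, smul_apply,
      ContinuousLinearMap.id_apply, add_sub_cancel_right, norm_smul, Real.norm_eq_abs,
      abs_of_pos hr]
    nlinarith
  obtain ⟨⟨T, c⟩, hTS, hmax⟩ := hScomp.exists_isMaxOn ⟨_, hS₀⟩
    (f := fun p => |p.1.det|)
    (ContinuousLinearMap.continuous_det.comp continuous_fst).abs.continuousOn
  have hT : T.det ≠ 0 := by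
    have h := hmax hS₀
    intro h0
    have h1 : (r • ContinuousLinearMap.id ℝ E).det = r ^ Module.finrank ℝ E := by
      simp [ContinuousLinearMap.det]
    simp only [mem_ofPred_eq, h0, h1, abs_zero] at h
    have : 0 < |r ^ Module.finrank ℝ E| := by positivity
    linarith
  let L := T.toContinuousLinearEquivOfDetNeZero hT
  let B : E ≃ᵃ[ℝ] E := L.toLinearEquiv.toAffineEquiv.trans (AffineEquiv.constVAdd ℝ E c)
  have hB : ∀ x, B x = T x + c := fun x => by
    simp [B, L, add_comm]
  refine ⟨B, fun u hu => ?_, fun T' c' h => ?_⟩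
  · rw [mem_preimage, hB]
    exact hTS u hu
  · have hmem : (T.comp T', T c' + c) ∈ S := by
      intro u hu
      have := h u hu
      rw [mem_preimage, hB] at this
      simpa [add_assoc] using this
    have h := hmax hmem
    have h1 : (T.comp T').det = T.det * T'.det := by
      simp [ContinuousLinearMap.det]
    simp only [mem_ofPred_eq, h1, abs_mul] at h
    have : 0 < |T.det| := abs_pos.2 hT
    by_contra! hlt
    nlinarith

/-- First order expansion of the determinant at the identity. -/
lemma tendsto_det_one_add_smul (M : E →L[ℝ] E) :
    Tendsto (fun t : ℝ => ((ContinuousLinearMap.id ℝ E + t • M).det - 1) / t) (𝓝[>] 0)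
      (𝓝 (LinearMap.trace ℝ E M)) := by
  let b := Module.finBasis ℝ E
  let N := LinearMap.toMatrix b b (M : E →ₗ[ℝ] E)
  let P : Polynomial ℝ :=
    (Matrix.det (1 + (Polynomial.X : Polynomial ℝ) • N.map Polynomial.C)).divX.divX
  have hdet : ∀ t : ℝ, (ContinuousLinearMap.id ℝ E + t • M).det =
      1 + LinearMap.trace ℝ E M * t + P.eval t * t ^ 2 := by
    intro t
    rw [LinearMap.trace_eq_matrix_trace ℝ b, ← Matrix.det_one_add_smul]
    rw [ContinuousLinearMap.det, ← LinearMap.det_toMatrix b]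
    simp
  have hlim : Tendsto (fun t : ℝ => LinearMap.trace ℝ E M + P.eval t * t) (𝓝[>] 0)
      (𝓝 (LinearMap.trace ℝ E M)) := by
    have : Continuous fun t : ℝ => LinearMap.trace ℝ E M + P.eval t * t := by
      fun_prop
    simpa using (this.tendsto 0).mono_left nhdsWithin_le_nhds
  refine hlim.congr' ?_
  filter_upwards [self_mem_nhdsWithin] with t ht
  have ht0 : t ≠ 0 := ne_of_gt ht
  rw [hdet]
  field_simp
  ring

/-- Variational characterization of John position: a first order deformation of the unit ball
that moves inwards at every contact point does not increase the volume. -/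
lemma IsJohnPosition.trace_nonpos {K : Set E} (hJ : IsJohnPosition K) (hconv : Convex ℝ K)
    (hcl : IsClosed K) (M : E →L[ℝ] E) (b : E)
    (hM : ∀ u ∈ unitContacts K, ⟪u, M u + b⟫_ℝ < 0) : LinearMap.trace ℝ E M ≤ 0 := by
  have hev : ∀ᶠ t : ℝ in 𝓝 0, ∀ q ∈ sphere (0 : E) 1 ×ˢ closedBall (0 : E) 1,
      q ∈ sphere (0 : E) 1 ×ˢ closedBall (0 : E) 1 → 0 < t →
        ∃ y ∈ K, ⟪q.1, q.2 + t • (M q.2 + b)⟫_ℝ < ⟪q.1, y⟫_ℝ := by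
    refine ((isCompact_sphere _ _).prod (isCompact_closedBall _ _)
      ).eventually_forall_of_forall_eventually ?_
    rintro ⟨v, p⟩ ⟨hv, hp⟩
    simp only [mem_sphere_iff_norm, sub_zero, mem_closedBall] at hv hp
    rw [dist_zero_right] at hp
    have hvp : ⟪v, p⟫_ℝ ≤ 1 := (real_inner_le_norm v p).trans (by rw [hv, one_mul]; exact hp)
    by_cases hsep : ∃ y ∈ K, ⟪v, p⟫_ℝ < ⟪v, y⟫_ℝ
    · obtain ⟨y, hy, hlt⟩ := hsep
      have h1 : ∀ᶠ z : ℝ × (E × E) in 𝓝 (0, (v, p)),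
          ⟪z.2.1, z.2.2 + z.1 • (M z.2.2 + b)⟫_ℝ < ⟪z.2.1, y⟫_ℝ := by
        refine ContinuousAt.eventually_lt (by fun_prop) (by fun_prop) ?_
        simpa using hlt
      filter_upwards [h1] with z hz _ _ using ⟨y, hy, hz⟩
    · push Not at hsep
      have hvK : v ∈ K := hJ.1 (by simp [hv])
      have hvv : ⟪v, v⟫_ℝ = 1 := by rw [real_inner_self_eq_norm_sq, hv, one_pow]
      have hvp1 : ⟪v, p⟫_ℝ = 1 := le_antisymm hvp (hvv ▸ hsep v hvK)
      have hpv : p = v := by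
        have h := norm_sub_sq_real v p
        have h2 : ‖v - p‖ ^ 2 ≤ 0 := by rw [h, hv, hvp1]; nlinarith [norm_nonneg p]
        have h3 : ‖v - p‖ = 0 := by nlinarith [norm_nonneg (v - p)]
        exact (sub_eq_zero.1 (norm_eq_zero.1 h3)).symm
      subst hpv
      have hneg := hM p ⟨hv, fun y hy => hvp1 ▸ hsep y hy⟩
      have h1 : ∀ᶠ z : ℝ × (E × E) in 𝓝 (0, (p, p)), ⟪z.2.1, M z.2.2 + b⟫_ℝ < 0 := by
        refine ContinuousAt.eventually_lt (by fun_prop) (by fun_prop) ?_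
        simpa using hneg
      filter_upwards [h1] with z hz hmem ht
      obtain ⟨hz1, hz2⟩ := hmem
      simp only [mem_sphere_iff_norm, sub_zero, mem_closedBall, dist_zero_right] at hz1 hz2
      refine ⟨z.2.1, hJ.1 (by simp [hz1]), ?_⟩
      rw [real_inner_self_eq_norm_sq, hz1, inner_add_right, real_inner_smul_right]
      have h3 := real_inner_le_norm z.2.1 z.2.2
      rw [hz1] at h3
      nlinarith [mul_neg_of_pos_of_neg ht hz]
  have hne : K.Nonempty := ⟨0, hJ.1 (by simp)⟩
  refine le_of_tendsto (tendsto_det_one_add_smul M) ?_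
  filter_upwards [self_mem_nhdsWithin, nhdsWithin_le_nhds hev] with t ht hq
  have ht' : 0 < t := ht
  refine div_nonpos_of_nonpos_of_nonneg (sub_nonpos.2 ?_) ht'.le
  refine (le_abs_self _).trans (hJ.2 _ (t • b) fun p hp => ?_)
  by_contra hpK
  obtain ⟨v, hv, hsep⟩ := exists_unit_inner_lt_of_notMem hconv hcl hne hpK
  obtain ⟨y, hy, hlt⟩ := hq (v, p) ⟨hv, hp⟩ ⟨hv, hp⟩ ht'
  have h1 := hsep y hy
  have h2 : (ContinuousLinearMap.id ℝ E + t • M) p + t • b = p + t • (M p + b) := by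
    simp [add_assoc]
  rw [h2] at h1
  exact lt_asymm h1 hlt

lemma IsJohnPosition.trace_nonneg {K : Set E} (hJ : IsJohnPosition K) (hconv : Convex ℝ K)
    (hcl : IsClosed K) (M : E →L[ℝ] E) (b : E)
    (hM : ∀ u ∈ unitContacts K, 0 ≤ ⟪u, M u + b⟫_ℝ) : 0 ≤ LinearMap.trace ℝ E M := by
  by_contra! hneg
  set d : ℝ := (Module.finrank ℝ E : ℝ)
  have hd : 0 ≤ d := Nat.cast_nonneg _
  set ε : ℝ := -LinearMap.trace ℝ E M / (2 * (d + 1))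
  have hε : 0 < ε := div_pos (by linarith) (by positivity)
  have h := hJ.trace_nonpos hconv hcl (-M - ε • ContinuousLinearMap.id ℝ E) (-b) fun u hu => by
    have h1 := hM u hu
    have h2 : ⟪u, u⟫_ℝ = 1 := by rw [real_inner_self_eq_norm_sq, hu.1, one_pow]
    rw [inner_add_right] at h1
    simp only [sub_apply, neg_apply, smul_apply,
      ContinuousLinearMap.id_apply, inner_add_right, inner_sub_right, inner_neg_right,
      real_inner_smul_right, h2]
    linarith
  have h3 : LinearMap.trace ℝ E ((-M - ε • ContinuousLinearMap.id ℝ E : E →L[ℝ] E) : E →ₗ[ℝ] E)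
      = -LinearMap.trace ℝ E M - ε * d := by
    simp [d]
  rw [h3] at h
  have h4 : ε * (2 * (d + 1)) = -LinearMap.trace ℝ E M := by
    simp only [ε]; field_simp
  nlinarith

/-- On unit vectors, `⟪u, contactForm r x y u + (y - r • x)⟫ = (1 - ⟪x, u⟫) * (r + ⟪y, u⟫)`. -/
noncomputable def contactForm (r : ℝ) (x y : E) : E →L[ℝ] E :=
  r • ContinuousLinearMap.id ℝ E - InnerProductSpace.rankOne ℝ y x

omit [FiniteDimensional ℝ E] in
lemma inner_contactForm (r : ℝ) (x y : E) {u : E} (hu : ‖u‖ = 1) :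
    ⟪u, contactForm r x y u + (y - r • x)⟫_ℝ = (1 - ⟪x, u⟫_ℝ) * (r + ⟪y, u⟫_ℝ) := by
  have h2 : ⟪u, u⟫_ℝ = 1 := by rw [real_inner_self_eq_norm_sq, hu, one_pow]
  simp only [contactForm, sub_apply, smul_apply, ContinuousLinearMap.id_apply,
    InnerProductSpace.rankOne_apply, inner_add_right, inner_sub_right, real_inner_smul_right, h2,
    real_inner_comm u]
  ring

lemma trace_contactForm (r : ℝ) (x y : E) :
    LinearMap.trace ℝ E (contactForm r x y) = r * Module.finrank ℝ E - ⟪x, y⟫_ℝ := by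
  simp [contactForm, InnerProductSpace.trace_rankOne]

omit [FiniteDimensional ℝ E] in
lemma contactForm_self_nonneg {K : Set E} {x u : E} (hx : x ∈ K) (hu : u ∈ unitContacts K) {r : ℝ}
    (hr : ‖x‖ ≤ r) : 0 ≤ (1 - ⟪x, u⟫_ℝ) * (r + ⟪x, u⟫_ℝ) := by
  have h1 := hu.2 x hx
  have h2 := neg_le_of_abs_le (abs_real_inner_le_norm x u)
  rw [hu.1, mul_one] at h2
  rw [real_inner_comm] at h1
  exact mul_nonneg (by linarith) (by linarith)

section Bounds

variable {K : Set E} (hJ : IsJohnPosition K) (hconv : Convex ℝ K) (hcl : IsClosed K)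
include hJ hconv hcl

lemma IsJohnPosition.inner_le (r : ℝ) (x y : E)
    (h : ∀ u ∈ unitContacts K, 0 ≤ (1 - ⟪x, u⟫_ℝ) * (r + ⟪y, u⟫_ℝ)) :
    ⟪x, y⟫_ℝ ≤ r * Module.finrank ℝ E := by
  have := hJ.trace_nonneg hconv hcl (contactForm r x y) (y - r • x) fun u hu => by
    rw [inner_contactForm r x y hu.1]
    exact h u hu
  rw [trace_contactForm] at this
  linarith

lemma IsJohnPosition.neg_finrank_le_inner {x y : E} (hx : x ∈ K) (hy : y ∈ K) :
    -(Module.finrank ℝ E : ℝ) ≤ ⟪x, y⟫_ℝ := by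
  have := hJ.inner_le hconv hcl 1 x (-y) fun u hu => by
    have h1 := hu.2 x hx
    have h2 := hu.2 y hy
    rw [inner_neg_left, real_inner_comm, real_inner_comm u y]
    exact mul_nonneg (by linarith) (by linarith)
  rw [inner_neg_right] at this
  linarith

lemma IsJohnPosition.norm_le {x : E} (hx : x ∈ K) : ‖x‖ ≤ Module.finrank ℝ E := by
  have h := hJ.inner_le hconv hcl ‖x‖ x x fun u hu => contactForm_self_nonneg hx hu le_rfl
  rw [real_inner_self_eq_norm_sq] at h
  by_contra! hlt
  have : (0 : ℝ) ≤ Module.finrank ℝ E := Nat.cast_nonneg _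
  nlinarith

lemma IsJohnPosition.norm_sub_sq_le {x y : E} (hx : x ∈ K) (hy : y ∈ K) :
    ‖x - y‖ ^ 2 ≤ 2 * Module.finrank ℝ E * ((Module.finrank ℝ E : ℝ) + 1) := by
  rw [norm_sub_sq_real]
  nlinarith [hJ.norm_le hconv hcl hx, hJ.norm_le hconv hcl hy,
    hJ.neg_finrank_le_inner hconv hcl hx hy, norm_nonneg x, norm_nonneg y]

/-- Points realizing the extremal distance have extremal norm. -/
lemma IsJohnPosition.norm_eq_of_norm_sub_sq_eq {x y : E} (hx : x ∈ K) (hy : y ∈ K)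
    (h : ‖x - y‖ ^ 2 = 2 * Module.finrank ℝ E * ((Module.finrank ℝ E : ℝ) + 1)) :
    ‖x‖ = Module.finrank ℝ E ∧ ‖y‖ = Module.finrank ℝ E := by
  rw [norm_sub_sq_real] at h
  have h1 := hJ.norm_le hconv hcl hx
  have h2 := hJ.norm_le hconv hcl hy
  have h3 := hJ.neg_finrank_le_inner hconv hcl hx hy
  constructor <;> nlinarith [norm_nonneg x, norm_nonneg y]

lemma IsJohnPosition.inner_eq_neg_finrank (hd : 0 < Module.finrank ℝ E) {x y : E} (hx : x ∈ K)
    (hy : y ∈ K) (hxn : ‖x‖ = Module.finrank ℝ E) (hyn : ‖y‖ = Module.finrank ℝ E)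
    (hxy : x ≠ y) : ⟪x, y⟫_ℝ = -(Module.finrank ℝ E : ℝ) := by
  set d : ℝ := (Module.finrank ℝ E : ℝ) with hd_def
  have hd' : 0 < d := by rw [hd_def]; exact_mod_cast hd
  by_contra hne
  set q : E → E → ℝ := fun z u => (1 - ⟪z, u⟫_ℝ) * (d + ⟪z, u⟫_ℝ) with hq
  have hzero : ∀ z w : E, ‖z‖ = d → ‖w‖ = d → ⟪z, w⟫_ℝ ≠ -d → z ≠ w → ∀ u : E, ‖u‖ = 1 →
      q z u = 0 → q w u = 0 → ⟪z, u⟫_ℝ = 1 := by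
    intro z w hz hw hzw hne u hu h1 h2
    have key : ∀ z : E, ‖z‖ = d → d + ⟪z, u⟫_ℝ = 0 → z = -(d • u) := by
      intro z hz h
      have h0 : ‖z + d • u‖ ^ 2 = 0 := by
        rw [norm_add_sq_real, hz, norm_smul, hu, real_inner_smul_right, Real.norm_eq_abs,
          abs_of_pos hd']
        linear_combination 2 * d * h
      exact eq_neg_of_add_eq_zero_left (norm_eq_zero.1 (pow_eq_zero_iff two_ne_zero |>.1 h0))
    rcases mul_eq_zero.1 h1 with h1 | h1
    · linarith
    · have hz' := key z hz h1
      rcases mul_eq_zero.1 h2 with h2 | h2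
      · exfalso
        apply hzw
        rw [hz', inner_neg_left, real_inner_smul_left, real_inner_comm]
        have : ⟪w, u⟫_ℝ = 1 := by linarith
        rw [this, mul_one]
      · exact absurd (hz'.trans (key w hw h2).symm) hne
  have hev : ∀ᶠ ε : ℝ in 𝓝 0, ∀ u ∈ unitContacts K, u ∈ unitContacts K → 0 < ε →
      0 < q x u + q y u + ε * (⟪x, u⟫_ℝ - 1 / 2) := by
    refine (isCompact_unitContacts K).eventually_forall_of_forall_eventually fun u hu => ?_
    have h1 := contactForm_self_nonneg hx hu hxn.le
    have h2 := contactForm_self_nonneg hy hu hyn.le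
    by_cases hpos : 0 < q x u + q y u
    · have : ∀ᶠ z : ℝ × E in 𝓝 (0, u),
          0 < q x z.2 + q y z.2 + z.1 * (⟪x, z.2⟫_ℝ - 1 / 2) := by
        refine ContinuousAt.eventually_lt (by fun_prop) (by fun_prop) ?_
        simpa using hpos
      filter_upwards [this] with z hz _ _ using hz
    · have hx1 := hzero x y hxn hyn hne hxy u hu.1 (by simp only [hq] at *; linarith)
        (by simp only [hq] at *; linarith)
      have : ∀ᶠ z : ℝ × E in 𝓝 (0, u), 0 < ⟪x, z.2⟫_ℝ - 1 / 2 := by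
        refine ContinuousAt.eventually_lt (by fun_prop) (by fun_prop) ?_
        simp only [hx1]; norm_num
      filter_upwards [this] with z hz hzu hε
      have h1 := contactForm_self_nonneg hx hzu hxn.le
      have h2 := contactForm_self_nonneg hy hzu hyn.le
      have h3 := mul_pos hε hz
      simp only [hq]
      linarith
  obtain ⟨ε, hε, hεpos⟩ :=
    ((hev.filter_mono (nhdsWithin_le_nhds (s := Ioi (0 : ℝ)))).and self_mem_nhdsWithin).exists
  have hεpos' : 0 < ε := hεpos
  have htr := hJ.trace_nonneg hconv hcl
    (contactForm d x x + contactForm d y y - (ε / 2) • ContinuousLinearMap.id ℝ E)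
    ((x - d • x) + (y - d • y) + ε • x) fun u hu => by
      have h := hε u hu hu hεpos'
      have hx' := inner_contactForm d x x hu.1
      have hy' := inner_contactForm d y y hu.1
      have h2 : ⟪u, u⟫_ℝ = 1 := by rw [real_inner_self_eq_norm_sq, hu.1, one_pow]
      have heq : (contactForm d x x + contactForm d y y - (ε / 2) • ContinuousLinearMap.id ℝ E) u
          + ((x - d • x) + (y - d • y) + ε • x) =
          (contactForm d x x u + (x - d • x)) + (contactForm d y y u + (y - d • y))
            + (ε • x - (ε / 2) • u) := by
        simp only [sub_apply, add_apply, smul_apply, ContinuousLinearMap.id_apply]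
        abel
      rw [heq, inner_add_right, inner_add_right, hx', hy', inner_sub_right,
        real_inner_smul_right, real_inner_smul_right, h2, real_inner_comm]
      simp only [hq] at h
      rw [real_inner_comm] at h
      rw [real_inner_comm u x] at *
      linarith
  have h3 : LinearMap.trace ℝ E ((contactForm d x x + contactForm d y y -
      (ε / 2) • ContinuousLinearMap.id ℝ E : E →L[ℝ] E) : E →ₗ[ℝ] E)
      = -(ε / 2 * d) := by
    have hx' := trace_contactForm d x x
    have hy' := trace_contactForm d y y
    rw [real_inner_self_eq_norm_sq, hxn, ← hd_def] at hx'
    rw [real_inner_self_eq_norm_sq, hyn, ← hd_def] at hy'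
    simp only [ContinuousLinearMap.toLinearMap_sub, ContinuousLinearMap.toLinearMap_add,
      ContinuousLinearMap.toLinearMap_smul, map_sub, map_add, map_smul, hx', hy']
    simp [d]
    ring
  rw [h3] at htr
  nlinarith [mul_pos hεpos' hd']

end Bounds

/-- Points of norm `d = dim E` with pairwise inner products `-d` in a convex set contained in the
half-spaces `-d ≤ ⟪y, p j⟫` are the vertices of a simplex equal to this set. -/
lemma eq_convexHull_of_inner_eq {K : Set E} (hconv : Convex ℝ K)
    (hd : 0 < Module.finrank ℝ E) {ι : Type*} [Fintype ι]
    (hcard : Fintype.card ι = Module.finrank ℝ E + 1) (p : ι → E) (hp : ∀ i, p i ∈ K)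
    (hnorm : ∀ i, ‖p i‖ = Module.finrank ℝ E)
    (hinner : ∀ i j, i ≠ j → ⟪p i, p j⟫_ℝ = -(Module.finrank ℝ E : ℝ))
    (hK : ∀ y ∈ K, ∀ j, -(Module.finrank ℝ E : ℝ) ≤ ⟪y, p j⟫_ℝ) :
    AffineIndependent ℝ p ∧ K = convexHull ℝ (range p) := by
  classical
  set d : ℝ := (Module.finrank ℝ E : ℝ) with hd_def
  have hd' : 0 < d := by rw [hd_def]; exact_mod_cast hd
  have hgram : ∀ i j, ⟪p i, p j⟫_ℝ = (if i = j then d * (d + 1) else 0) - d := by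
    intro i j
    split_ifs with h
    · rw [h, real_inner_self_eq_norm_sq, hnorm]; ring
    · rw [hinner i j h]; ring
  have hcomb : ∀ (s : Finset ι) (w : ι → ℝ), ∀ j ∈ s,
      ⟪∑ i ∈ s, w i • p i, p j⟫_ℝ = w j * (d * (d + 1)) - (∑ i ∈ s, w i) * d := by
    intro s w j hj
    simp only [sum_inner, real_inner_smul_left, hgram, mul_sub, Finset.sum_sub_distrib, mul_ite,
      mul_zero, Finset.sum_ite_eq', hj, if_true, Finset.sum_mul]
  have hind : AffineIndependent ℝ p := by
    rw [affineIndependent_iff]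
    intro s w hw hs j hj
    have h := hcomb s w j hj
    rw [hs, hw, inner_zero_left, zero_mul, sub_zero] at h
    exact (mul_eq_zero.1 h.symm).resolve_right (by positivity)
  refine ⟨hind, Subset.antisymm (fun y hy => ?_) (convexHull_min (range_subset_iff.2 hp) hconv)⟩
  let b : AffineBasis ι ℝ E :=
    ⟨p, hind, hind.affineSpan_eq_top_iff_card_eq_finrank_add_one.2 hcard⟩
  have hb : convexHull ℝ (range p) = {x | ∀ i, 0 ≤ b.coord i x} := b.convexHull_eq_nonneg_coord
  rw [hb]
  intro j
  have h1 := hcomb Finset.univ (fun i => b.coord i y) j (Finset.mem_univ j)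
  have h2 : ∑ i, b.coord i y • p i = y := b.linear_combination_coord_eq_self y
  rw [h2, b.sum_coord_apply_eq_one] at h1
  have h3 := hK y hy j
  by_contra! hneg
  nlinarith [mul_pos hd' (by linarith : 0 < d + 1)]

omit [FiniteDimensional ℝ E] in
/-- The simplex spanned by at most `d` points of norm `d` with pairwise inner products `-d`
has no supporting half-space `⟪u, x⟫ ≤ 1` with unit normal `u` parallel to the simplex. -/
lemma exists_one_lt_inner_of_mem_vectorSpan (F : Finset E) {d : ℝ} (hd : 0 < d)
    (hcard : (F.card : ℝ) ≤ d) (hnorm : ∀ x ∈ F, ‖x‖ = d)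
    (hinner : ∀ x ∈ F, ∀ y ∈ F, x ≠ y → ⟪x, y⟫_ℝ = -d) {u : E} (hu : ‖u‖ = 1)
    (huF : u ∈ vectorSpan ℝ (F : Set E)) : ∃ x ∈ F, 1 < ⟪u, x⟫_ℝ := by
  classical
  by_contra! hle
  have hgram : ∀ x ∈ F, ∀ y ∈ F, ⟪x, y⟫_ℝ = (if x = y then d * (d + 1) else 0) - d := by
    intro x hx y hy
    split_ifs with h
    · rw [h, real_inner_self_eq_norm_sq, hnorm y hy]; ring
    · rw [hinner x hx y hy h]; ring
  have hspan : ∑ x ∈ F, ⟪u, x⟫_ℝ = 0 ∧ ∑ x ∈ F, ⟪u, x⟫_ℝ • x = (d * (d + 1)) • u := by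
    clear hu hle
    rw [vectorSpan_def] at huF
    induction huF using Submodule.span_induction with
    | mem w hw =>
      obtain ⟨y, hy, z, hz, rfl⟩ := hw
      have hyz : ∀ x ∈ F, ⟪y -ᵥ z, x⟫_ℝ =
          (if y = x then d * (d + 1) else 0) - (if z = x then d * (d + 1) else 0) := by
        intro x hx
        rw [vsub_eq_sub, inner_sub_left, hgram y hy x hx, hgram z hz x hx]
        ring
      have hy' : y ∈ F := hy
      have hz' : z ∈ F := hz
      constructor
      · rw [Finset.sum_congr rfl hyz]
        simp [hy', hz']
      · rw [Finset.sum_congr rfl fun x hx => by rw [hyz x hx]]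
        simp [sub_smul, ite_smul, hy', hz', smul_sub]
    | zero => simp
    | add v w _ _ hv hw =>
      simp only [inner_add_left, Finset.sum_add_distrib, add_smul, smul_add, hv.1, hw.1, hv.2,
        hw.2, add_zero, and_self]
    | smul a v _ hv =>
      simp only [real_inner_smul_left, ← Finset.mul_sum, mul_smul, ← Finset.smul_sum, hv.1, hv.2,
        mul_zero, true_and]
      module
  obtain ⟨hsum, hframe⟩ := hspan
  have hsq : ∑ x ∈ F, ⟪u, x⟫_ℝ ^ 2 = d * (d + 1) := by
    have h := congrArg (fun z => ⟪u, z⟫_ℝ) hframe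
    simp only [inner_sum, real_inner_smul_right, real_inner_self_eq_norm_sq, hu] at h
    simpa [sq] using h
  set k : ℝ := (F.card : ℝ)
  have hlower : ∀ x ∈ F, -(k - 1) ≤ ⟪u, x⟫_ℝ := by
    intro x hx
    have h1 := Finset.add_sum_erase F (fun x => ⟪u, x⟫_ℝ) hx
    have h2 : ∑ y ∈ F.erase x, ⟪u, y⟫_ℝ ≤ ∑ y ∈ F.erase x, (1 : ℝ) :=
      Finset.sum_le_sum fun y hy => hle y (Finset.mem_of_mem_erase hy)
    rw [Finset.sum_const, nsmul_one, Finset.cast_card_erase_of_mem hx] at h2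
    linarith
  have hprod : 0 ≤ ∑ x ∈ F, (1 - ⟪u, x⟫_ℝ) * (⟪u, x⟫_ℝ + (k - 1)) :=
    Finset.sum_nonneg fun x hx =>
      mul_nonneg (by linarith [hle x hx]) (by linarith [hlower x hx])
  have hexp : ∑ x ∈ F, (1 - ⟪u, x⟫_ℝ) * (⟪u, x⟫_ℝ + (k - 1)) =
      k * (k - 1) + (2 - k) * ∑ x ∈ F, ⟪u, x⟫_ℝ - ∑ x ∈ F, ⟪u, x⟫_ℝ ^ 2 := by
    rw [Finset.mul_sum, ← nsmul_eq_mul, ← Finset.sum_const, ← Finset.sum_add_distrib,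
      ← Finset.sum_sub_distrib]
    exact Finset.sum_congr rfl fun x _ => by ring
  rw [hexp, hsum, hsq] at hprod
  have hk : 0 ≤ k := Nat.cast_nonneg _
  nlinarith

/-- A first order deformation moving outwards at all contact points and contracting all diameters
yields an affine image that still contains the unit ball but has smaller diameter. -/
lemma exists_affineEquiv_diam_lt {K : Set E} (hconv : Convex ℝ K) (hK : IsCompact K)
    (hball : closedBall (0 : E) 1 ⊆ K) {D : ℝ} (hdiam : ∀ x ∈ K, ∀ y ∈ K, ‖x - y‖ ≤ D)
    (M : E →L[ℝ] E) (hM : ∀ u ∈ unitContacts K, 0 < ⟪u, M u⟫_ℝ)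
    (hD : ∀ x ∈ K, ∀ y ∈ K, ‖x - y‖ = D → ⟪x - y, M (x - y)⟫_ℝ < 0) :
    ∃ A : E ≃ᵃ[ℝ] E, closedBall (0 : E) 1 ⊆ A '' K ∧ diam (A '' K) < D := by
  have hne : K.Nonempty := ⟨0, hball (by simp)⟩
  have hev₁ : ∀ᶠ t : ℝ in 𝓝 0, ∀ v ∈ sphere (0 : E) 1, v ∈ sphere (0 : E) 1 → 0 < t →
      ∃ y ∈ K, 1 < ⟪v, y + t • M y⟫_ℝ := by
    refine (isCompact_sphere _ _).eventually_forall_of_forall_eventually fun v hv => ?_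
    have hv1 : ‖v‖ = 1 := by simpa using hv
    by_cases hsep : ∃ y ∈ K, 1 < ⟪v, y⟫_ℝ
    · obtain ⟨y, hy, hlt⟩ := hsep
      have h1 : ∀ᶠ z : ℝ × E in 𝓝 (0, v), 1 < ⟪z.2, y + z.1 • M y⟫_ℝ := by
        refine ContinuousAt.eventually_lt (by fun_prop) (by fun_prop) ?_
        simpa using hlt
      filter_upwards [h1] with z hz _ _ using ⟨y, hy, hz⟩
    · push Not at hsep
      have h1 : ∀ᶠ z : ℝ × E in 𝓝 (0, v), 0 < ⟪z.2, M z.2⟫_ℝ := by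
        refine ContinuousAt.eventually_lt (by fun_prop) (by fun_prop) ?_
        exact hM v ⟨hv1, hsep⟩
      filter_upwards [h1] with z hz hz1 ht
      have hz1 : ‖z.2‖ = 1 := by simpa using hz1
      refine ⟨z.2, hball (by simp [hz1]), ?_⟩
      rw [inner_add_right, real_inner_smul_right, real_inner_self_eq_norm_sq, hz1]
      nlinarith [mul_pos ht hz]
  have hev₂ : ∀ᶠ t : ℝ in 𝓝 0, ∀ q ∈ K ×ˢ K, q ∈ K ×ˢ K → 0 < t →
      ‖(q.1 - q.2) + t • M (q.1 - q.2)‖ < D := by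
    refine (hK.prod hK).eventually_forall_of_forall_eventually ?_
    rintro ⟨x, y⟩ ⟨hx, hy⟩
    rcases (hdiam x hx y hy).lt_or_eq with hlt | heq
    · have h1 : ∀ᶠ z : ℝ × (E × E) in 𝓝 (0, (x, y)),
          ‖(z.2.1 - z.2.2) + z.1 • M (z.2.1 - z.2.2)‖ < D := by
        refine ContinuousAt.eventually_lt (by fun_prop) (by fun_prop) ?_
        simpa using hlt
      filter_upwards [h1] with z hz _ _ using hz
    · have h1 : ∀ᶠ z : ℝ × (E × E) in 𝓝 (0, (x, y)),
          2 * ⟪z.2.1 - z.2.2, M (z.2.1 - z.2.2)⟫_ℝ + z.1 * ‖M (z.2.1 - z.2.2)‖ ^ 2 < 0 := by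
        refine ContinuousAt.eventually_lt (by fun_prop) (by fun_prop) ?_
        simpa only [zero_mul, add_zero] using by linarith [hD x hx y hy heq]
      filter_upwards [h1] with z hz hmem ht
      have hzD := hdiam _ hmem.1 _ hmem.2
      have hD0 : 0 ≤ D := (norm_nonneg _).trans hzD
      refine lt_of_pow_lt_pow_left₀ 2 hD0 ?_
      rw [norm_add_sq_real, norm_smul, real_inner_smul_right, Real.norm_eq_abs, abs_of_pos ht]
      nlinarith [mul_neg_of_pos_of_neg ht hz, norm_nonneg (z.2.1 - z.2.2)]
  have hev₃ : ∀ᶠ t : ℝ in 𝓝 0, (ContinuousLinearMap.id ℝ E + t • M).det ≠ 0 := by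
    have hcont : Continuous fun t : ℝ => (ContinuousLinearMap.id ℝ E + t • M).det :=
      ContinuousLinearMap.continuous_det.comp (by fun_prop)
    refine hcont.continuousAt.eventually_ne ?_
    simp [ContinuousLinearMap.det]
  obtain ⟨t, ⟨h1, h2, h3⟩, ht⟩ := (((hev₁.and (hev₂.and hev₃)).filter_mono
    (nhdsWithin_le_nhds (s := Ioi (0 : ℝ)))).and self_mem_nhdsWithin).exists
  have ht : 0 < t := ht
  let L := (ContinuousLinearMap.id ℝ E + t • M).toContinuousLinearEquivOfDetNeZero h3
  let A : E ≃ᵃ[ℝ] E := L.toLinearEquiv.toAffineEquiv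
  have hA : ∀ x, A x = x + t • M x := fun x => by simp [A, L]
  have hAL : ⇑A = ⇑L := rfl
  have himg : IsCompact (A '' K) := hK.image (hAL ▸ L.continuous)
  refine ⟨A, fun p hp => ?_, ?_⟩
  · by_contra hpK
    obtain ⟨v, hv, hsep⟩ := exists_unit_inner_lt_of_notMem
      (hconv.affine_image A.toAffineMap) himg.isClosed (hne.image A) hpK
    obtain ⟨y, hy, hlt⟩ := h1 v hv hv ht
    have h4 := hsep (A y) ⟨y, hy, rfl⟩
    rw [hA] at h4
    have h5 := real_inner_le_norm v p
    have hv1 : ‖v‖ = 1 := by simpa using hv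
    have hp1 : ‖p‖ ≤ 1 := by simpa using hp
    rw [hv1, one_mul] at h5
    linarith
  · obtain ⟨⟨x₀, y₀⟩, hmem, hmax⟩ := (hK.prod hK).exists_isMaxOn (hne.prod hne)
      (f := fun q : E × E => ‖(q.1 - q.2) + t • M (q.1 - q.2)‖) (by fun_prop)
    refine lt_of_le_of_lt (diam_le_of_forall_dist_le (norm_nonneg _) ?_) (h2 _ hmem hmem ht)
    rintro _ ⟨x, hx, rfl⟩ _ ⟨y, hy, rfl⟩
    have h4 : A x - A y = (x - y) + t • M (x - y) := by
      rw [hA, hA, map_sub, smul_sub]; abel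
    rw [dist_eq_norm, h4]
    exact hmax (show (x, y) ∈ K ×ˢ K from ⟨hx, hy⟩)

/-- A convex body in John position that is not a simplex can be deformed to a body of diameter
smaller than that of the regular simplex circumscribed about the unit ball. -/
lemma IsJohnPosition.exists_affineEquiv_diam_lt {K : Set E} (hJ : IsJohnPosition K)
    (hconv : Convex ℝ K) (hK : IsCompact K) (hd : 0 < Module.finrank ℝ E)
    (hsimplex : ¬ ∃ p : Fin (Module.finrank ℝ E + 1) → E,
      AffineIndependent ℝ p ∧ K = convexHull ℝ (range p)) :
    ∃ A : E ≃ᵃ[ℝ] E, closedBall (0 : E) 1 ⊆ A '' K ∧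
      diam (A '' K) < √(2 * Module.finrank ℝ E * ((Module.finrank ℝ E : ℝ) + 1)) := by
  have hcl := hK.isClosed
  let V : Set E := {x | x ∈ K ∧ ‖x‖ = Module.finrank ℝ E}
  have hinner : ∀ x ∈ V, ∀ y ∈ V, x ≠ y → ⟪x, y⟫_ℝ = -(Module.finrank ℝ E : ℝ) :=
    fun x hx y hy hxy => hJ.inner_eq_neg_finrank hconv hcl hd hx.1 hy.1 hx.2 hy.2 hxy
  have hVcard : V.encard < (Module.finrank ℝ E + 1 : ℕ) := by
    by_contra! hge
    obtain ⟨t, htV, ht⟩ := exists_subset_encard_eq hge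
    have hfin : t.Finite := finite_of_encard_eq_coe ht
    have hcard : hfin.toFinset.card = Module.finrank ℝ E + 1 := by
      rw [hfin.encard_eq_coe_toFinset_card] at ht
      exact_mod_cast ht
    let e := (hfin.toFinset.equivFinOfCardEq hcard).symm
    have hmem : ∀ i, (e i : E) ∈ V := fun i => htV (hfin.mem_toFinset.1 (e i).2)
    exact hsimplex ⟨fun i => e i, eq_convexHull_of_inner_eq hconv hd (by simp) _
      (fun i => (hmem i).1) (fun i => (hmem i).2)
      (fun i j hij => hinner _ (hmem i) _ (hmem j)
        fun h => hij (e.injective (Subtype.ext h)))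
      (fun y hy j => hJ.neg_finrank_le_inner hconv hcl hy (hmem j).1)⟩
  have hVfin : V.Finite := encard_lt_top_iff.1 (hVcard.trans (ENat.natCast_lt_top _))
  have hFcard : (hVfin.toFinset.card : ℝ) ≤ Module.finrank ℝ E := by
    rw [hVfin.encard_eq_coe_toFinset_card] at hVcard
    have h : hVfin.toFinset.card < Module.finrank ℝ E + 1 := by exact_mod_cast hVcard
    exact_mod_cast Nat.lt_succ_iff.1 h
  have hd' : (0 : ℝ) < Module.finrank ℝ E := by exact_mod_cast hd
  let W : Submodule ℝ E := vectorSpan ℝ V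
  let P : E →L[ℝ] E := Wᗮ.starProjection
  have hcontact : ∀ u ∈ unitContacts K, 0 < ⟪u, P u⟫_ℝ := by
    intro u hu
    have hPu : P u ≠ 0 := by
      intro h0
      have huW : u ∈ W := by
        have := (Submodule.starProjection_apply_eq_zero_iff (K := Wᗮ)).1 h0
        rwa [Submodule.orthogonal_orthogonal] at this
      obtain ⟨x, hx, hlt⟩ := exists_one_lt_inner_of_mem_vectorSpan hVfin.toFinset hd' hFcard
        (fun x hx => (hVfin.mem_toFinset.1 hx).2)
        (fun x hx y hy => hinner x (hVfin.mem_toFinset.1 hx) y (hVfin.mem_toFinset.1 hy))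
        hu.1 (by simpa using huW)
      exact hlt.not_ge (hu.2 x (hVfin.mem_toFinset.1 hx).1)
    have h1 : ⟪u, P u⟫_ℝ = ‖P u‖ ^ 2 := by
      have hidem : P (P u) = P u :=
        Submodule.starProjection_eq_self_iff.2 (Submodule.starProjection_apply_mem _ u)
      have hsymm : ⟪P u, P u⟫_ℝ = ⟪u, P (P u)⟫_ℝ := Wᗮ.starProjection_isSymmetric u (P u)
      rw [← real_inner_self_eq_norm_sq, hsymm, hidem]
    rw [h1]
    have := norm_pos_iff.2 hPu
    positivity
  obtain ⟨δ, hδ, hδle⟩ := (isCompact_unitContacts K).exists_forall_le'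
    (f := fun u => ⟪u, P u⟫_ℝ) (by fun_prop) hcontact
  have hdiam : ∀ x ∈ K, ∀ y ∈ K, ‖x - y‖ ≤
      √(2 * Module.finrank ℝ E * ((Module.finrank ℝ E : ℝ) + 1)) := fun x hx y hy =>
    Real.le_sqrt_of_sq_le (hJ.norm_sub_sq_le hconv hcl hx hy)
  refine _root_.exists_affineEquiv_diam_lt hconv hK hJ.1 hdiam
    (P - (δ / 2) • ContinuousLinearMap.id ℝ E) (fun u hu => ?_) fun x hx y hy hxy => ?_
  · have h2 : ⟪u, u⟫_ℝ = 1 := by rw [real_inner_self_eq_norm_sq, hu.1, one_pow]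
    have h3 := hδle u hu
    simp only [sub_apply, smul_apply, ContinuousLinearMap.id_apply, inner_sub_right,
      real_inner_smul_right, h2]
    linarith
  · have hsq : ‖x - y‖ ^ 2 = 2 * Module.finrank ℝ E * ((Module.finrank ℝ E : ℝ) + 1) := by
      rw [hxy, Real.sq_sqrt (by positivity)]
    obtain ⟨hxn, hyn⟩ := hJ.norm_eq_of_norm_sub_sq_eq hconv hcl hx hy hsq
    have hW : x - y ∈ W := vsub_mem_vectorSpan ℝ (show x ∈ V from ⟨hx, hxn⟩) ⟨hy, hyn⟩
    have hP : P (x - y) = 0 :=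
      (Submodule.starProjection_apply_eq_zero_iff (K := Wᗮ)).2 (W.le_orthogonal_orthogonal hW)
    simp only [sub_apply, smul_apply, ContinuousLinearMap.id_apply, hP, zero_sub, inner_neg_right,
      real_inner_smul_right, real_inner_self_eq_norm_sq, hsq]
    have : 0 < 2 * (Module.finrank ℝ E : ℝ) * ((Module.finrank ℝ E : ℝ) + 1) := by positivity
    nlinarith

end JohnPosition

/-- every convex body has an invertible affine image whose
diameter-to-inradius ratio is at most `√(2n(n+1))/2`, with strict inequality
unless the body is a simplex. -/
theorem stmt18 (n : ℕ) (hn : 1 ≤ n)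
    (K : Set (EuclideanSpace ℝ (Fin n)))
    (hKcompact : IsCompact K) (hKconv : Convex ℝ K) (hKint : (interior K).Nonempty) :
    (∃ (A : EuclideanSpace ℝ (Fin n) ≃ᵃ[ℝ] EuclideanSpace ℝ (Fin n))
        (c : EuclideanSpace ℝ (Fin n)) (ρ : ℝ),
      0 < ρ ∧ Metric.closedBall c ρ ⊆ ⇑A '' K ∧
      Metric.diam (⇑A '' K) ≤ Real.sqrt (2 * n * ((n : ℝ) + 1)) * ρ) ∧
    ((¬ ∃ p : Fin (n + 1) → EuclideanSpace ℝ (Fin n),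
        AffineIndependent ℝ p ∧ K = convexHull ℝ (Set.range p)) →
      ∃ (A : EuclideanSpace ℝ (Fin n) ≃ᵃ[ℝ] EuclideanSpace ℝ (Fin n))
          (c : EuclideanSpace ℝ (Fin n)) (ρ : ℝ),
        0 < ρ ∧ Metric.closedBall c ρ ⊆ ⇑A '' K ∧
        Metric.diam (⇑A '' K) < Real.sqrt (2 * n * ((n : ℝ) + 1)) * ρ) := by
  obtain ⟨B, hJ⟩ := exists_affineEquiv_isJohnPosition hKcompact hKint
  have hfin : Module.finrank ℝ (EuclideanSpace ℝ (Fin n)) = n := by simp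
  have himg : ⇑B.symm '' K = B ⁻¹' K := B.toEquiv.symm.image_eq_preimage_symm K
  have hBcont : Continuous B.symm := B.symm.toAffineMap.continuous_of_finiteDimensional
  have hcomp : IsCompact (B ⁻¹' K) := himg ▸ hKcompact.image hBcont
  have hconv : Convex ℝ (B ⁻¹' K) := hKconv.affine_preimage B.toAffineMap
  refine ⟨⟨B.symm, 0, 1, one_pos, himg ▸ hJ.1, ?_⟩, fun hsimplex => ?_⟩
  · rw [himg, mul_one]
    refine Metric.diam_le_of_forall_dist_le (Real.sqrt_nonneg _) fun x hx y hy => ?_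
    rw [dist_eq_norm]
    have := hJ.norm_sub_sq_le hconv hcomp.isClosed hx hy
    rw [hfin] at this
    exact Real.le_sqrt_of_sq_le this
  · obtain ⟨A, hball, hdiam⟩ := hJ.exists_affineEquiv_diam_lt hconv hcomp (by omega) (by
      rw [hfin]
      rintro ⟨p, hp, hpK⟩
      refine hsimplex ⟨B ∘ p, hp.map' B.toAffineMap B.injective, ?_⟩
      rw [Set.range_comp, ← AffineEquiv.coe_toAffineMap, ← AffineMap.image_convexHull, ← hpK]
      exact (Set.image_preimage_eq K B.surjective).symm)
    refine ⟨B.symm.trans A, 0, 1, one_pos, ?_⟩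
    have htrans : ⇑(B.symm.trans A) '' K = A '' (B ⁻¹' K) := by
      rw [AffineEquiv.coe_trans, Set.image_comp, himg]
    rw [htrans, mul_one]
    rw [hfin] at hdiam
    exact ⟨hball, hdiam⟩
end
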